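/- arXiv:1808.09165 — 7 statements merged into one kernel-verified Lean document; each statement's English description precedes it below -/
import Mathlib

section
/- Let n ≥ k ≥ 1 and let w₁,…,wₙ be vectors in ℝᵏ. Then ∑ᵢ₌₁ⁿ wᵢ ⊗ wᵢ = I_k (i.e., ∑ᵢ₌₁ⁿ ⟨wᵢ, x⟩wᵢ = x for every x ∈ ℝᵏ) if and only if there exists an orthonormal basis f₁,…,fₙ of ℝⁿ such that for each i, wᵢ is the orthogonal projection of fᵢ onto ℝᵏ, where ℝᵏ is embedded in ℝⁿ as the subspace of vectors whose last n − k coordinates vanish. -/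
open scoped RealInnerProductSpace

/-- A finite family of vectors of `ℝᵏ` is a unit decomposition if and only if the rows of the
matrix with columns `w i` are orthonormal. -/
theorem sum_inner_smul_eq_self_iff_orthonormal_rows {ι κ : Type*} [Fintype ι] [Fintype κ]
    (w : ι → EuclideanSpace ℝ κ) :
    (∀ x : EuclideanSpace ℝ κ, ∑ i, ⟪w i, x⟫ • w i = x) ↔
      Orthonormal ℝ (fun j : κ => WithLp.toLp 2 (fun i : ι => w i j) : κ → EuclideanSpace ℝ ι) := by
  classical
  rw [orthonormal_iff_ite]
  constructor
  · intro h j l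
    have := congrArg (fun v : EuclideanSpace ℝ κ => v l) (h (EuclideanSpace.single j 1))
    simpa [PiLp.inner_apply, EuclideanSpace.inner_single_right, mul_comm, eq_comm] using this
  · intro h x
    ext l
    have h' : ∀ j l, ∑ i, w i j * w i l = if j = l then (1 : ℝ) else 0 := by
      intro j l
      simpa [PiLp.inner_apply, mul_comm] using h j l
    calc (∑ i, ⟪w i, x⟫ • w i) l = ∑ i, ∑ j, x j * (w i j * w i l) := by
          simp [PiLp.inner_apply, Finset.sum_mul, mul_assoc]
      _ = ∑ j, x j * ∑ i, w i j * w i l := by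
          rw [Finset.sum_comm]
          simp only [Finset.mul_sum]
      _ = x l := by simp [h']

/-- The transpose of an orthonormal basis of `ℝⁿ` is an orthonormal basis. -/
theorem OrthonormalBasis.exists_transpose {ι : Type*} [Fintype ι]
    (b : OrthonormalBasis ι ℝ (EuclideanSpace ℝ ι)) :
    ∃ c : OrthonormalBasis ι ℝ (EuclideanSpace ℝ ι), ∀ i j, c i j = b j i := by
  have hb : Orthonormal ℝ
      (fun j => WithLp.toLp 2 (fun i => b i j) : ι → EuclideanSpace ℝ ι) :=
    (sum_inner_smul_eq_self_iff_orthonormal_rows b).1 b.sum_repr'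
  have hb' : Orthonormal ℝ (Set.univ.domRestrict
      (fun j => WithLp.toLp 2 (fun i => b i j) : ι → EuclideanSpace ℝ ι)) :=
    hb.comp _ Subtype.val_injective
  obtain ⟨c, hc⟩ := Orthonormal.exists_orthonormalBasis_extension_of_card_eq
    finrank_euclideanSpace hb'
  refine ⟨c, fun i j => ?_⟩
  rw [hc i (Set.mem_univ i)]

/-- Vectors `w₁,…,wₙ` in `ℝᵏ` give a unit decomposition (`∑ wᵢ ⊗ wᵢ = I_k`) if and only if
there is an orthonormal basis `f₁,…,fₙ` of `ℝⁿ` such that each `wᵢ` is the orthogonal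
projection of `fᵢ` onto `ℝᵏ`, embedded in `ℝⁿ` as the vectors whose last `n − k`
coordinates vanish (i.e. `wᵢ` consists of the first `k` coordinates of `fᵢ`). -/
theorem unitDecomposition_iff_proj_orthonormalBasis {n k : ℕ} (hk : 1 ≤ k) (hkn : k ≤ n)
    (w : Fin n → EuclideanSpace ℝ (Fin k)) :
    (∀ x : EuclideanSpace ℝ (Fin k), ∑ i, ⟪w i, x⟫ • w i = x) ↔
      ∃ f : OrthonormalBasis (Fin n) ℝ (EuclideanSpace ℝ (Fin n)),
        ∀ (i : Fin n) (j : Fin k), w i j = f i (Fin.castLE hkn j) := by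
  rw [sum_inner_smul_eq_self_iff_orthonormal_rows]
  have hinj := Fin.castLE_injective hkn
  constructor
  · intro h
    set r : Fin k → EuclideanSpace ℝ (Fin n) := fun j => WithLp.toLp 2 (fun i => w i j)
    have hext : ∀ j, Function.extend (Fin.castLE hkn) r 0 (Fin.castLE hkn j) = r j :=
      hinj.extend_apply r 0
    have hrange : Orthonormal ℝ ((Set.range (Fin.castLE hkn)).domRestrict
        (Function.extend (Fin.castLE hkn) r 0)) := by
      convert h.comp _ (Equiv.ofInjective _ hinj).symm.injective using 1
      funext ⟨_, j, rfl⟩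
      simp [hext]
    obtain ⟨b, hb⟩ := Orthonormal.exists_orthonormalBasis_extension_of_card_eq
      finrank_euclideanSpace hrange
    obtain ⟨f, hf⟩ := b.exists_transpose
    refine ⟨f, fun i j => ?_⟩
    rw [hf, hb _ ⟨j, rfl⟩, hext]
  · rintro ⟨f, hf⟩
    obtain ⟨c, hc⟩ := f.exists_transpose
    have hrows : (fun j : Fin k => WithLp.toLp 2 fun i => w i j) = c ∘ Fin.castLE hkn := by
      funext j
      ext i
      simp [hf, hc]
    rw [hrows]
    exact c.orthonormal.comp _ hinj
end

section
/- Let S = {v₁,…,vₙ} be an (n,k)-uframe. Then F(S) = max{F(S') : S' an (n,k)-uframe} if and only if for every (n,k)-frame S̃ = {ṽ₁,…,ṽₙ} one has F(S̃)/F(S) ≤ √(det A_{S̃}). Likewise, F(S) = min{F(S') : S' an (n,k)-uframe} if and only if for every (n,k)-frame S̃ one has F(S̃)/F(S) ≥ √(det A_{S̃}). -/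
open MeasureTheory
open scoped RealInnerProductSpace ENNReal

/-- The operator `A_S = ∑ᵢ vᵢ ⊗ vᵢ` generated by a family of vectors in `ℝᵏ`. -/
noncomputable def frameOp {n k : ℕ} (v : Fin n → EuclideanSpace ℝ (Fin k)) :
    EuclideanSpace ℝ (Fin k) →ₗ[ℝ] EuclideanSpace ℝ (Fin k) :=
  ∑ i, LinearMap.smulRight (innerₛₗ ℝ (v i)) (v i)

/-- `S` is an `(n,k)`-uframe: `∑ᵢ vᵢ ⊗ vᵢ = I_k`. -/
def IsUframe {n k : ℕ} (v : Fin n → EuclideanSpace ℝ (Fin k)) : Prop :=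
  ∀ x : EuclideanSpace ℝ (Fin k), ∑ i, ⟪v i, x⟫ • v i = x

/-- `F(S)`: the volume of the projection of the cross-polytope generated by `S`,
namely the convex hull of `{±v₁,…,±vₙ}`. -/
noncomputable def Fvol {n k : ℕ} (v : Fin n → EuclideanSpace ℝ (Fin k)) : ℝ≥0∞ :=
  volume (convexHull ℝ (Set.range v ∪ Set.range fun i => -v i))

lemma frameOp_apply {n k : ℕ} (v : Fin n → EuclideanSpace ℝ (Fin k))
    (x : EuclideanSpace ℝ (Fin k)) : frameOp v x = ∑ i, ⟪v i, x⟫ • v i := by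
  simp [frameOp]

lemma IsUframe.frameOp_eq_id {n k : ℕ} {v : Fin n → EuclideanSpace ℝ (Fin k)}
    (hv : IsUframe v) : frameOp v = LinearMap.id :=
  LinearMap.ext fun x => by rw [frameOp_apply, hv x, LinearMap.id_apply]

lemma IsUframe.span_eq_top {n k : ℕ} {v : Fin n → EuclideanSpace ℝ (Fin k)}
    (hv : IsUframe v) : Submodule.span ℝ (Set.range v) = ⊤ := by
  refine Submodule.eq_top_iff'.2 fun x => ?_
  rw [← hv x]
  exact Submodule.sum_mem _ fun i _ =>
    Submodule.smul_mem _ _ (Submodule.subset_span (Set.mem_range_self i))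

lemma inner_frameOp {n k : ℕ} (v : Fin n → EuclideanSpace ℝ (Fin k))
    (x y : EuclideanSpace ℝ (Fin k)) : ⟪frameOp v x, y⟫ = ∑ i, ⟪v i, x⟫ * ⟪v i, y⟫ := by
  simp [frameOp_apply, sum_inner, real_inner_smul_left]

lemma frameOp_isPositive {n k : ℕ} (v : Fin n → EuclideanSpace ℝ (Fin k)) :
    (frameOp v).IsPositive := by
  refine ⟨fun x y => ?_, fun x => ?_⟩
  · rw [inner_frameOp, real_inner_comm, inner_frameOp]
    exact Finset.sum_congr rfl fun i _ => mul_comm _ _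
  · rw [RCLike.re_to_real, inner_frameOp]
    exact Finset.sum_nonneg fun i _ => mul_self_nonneg _

lemma frameOp_injective {n k : ℕ} {v : Fin n → EuclideanSpace ℝ (Fin k)}
    (hv : Submodule.span ℝ (Set.range v) = ⊤) : Function.Injective (frameOp v) := by
  refine (injective_iff_map_eq_zero _).2 fun x hx => ?_
  have hsum : ∑ i, ⟪v i, x⟫ * ⟪v i, x⟫ = 0 := by rw [← inner_frameOp, hx, inner_zero_left]
  rw [Finset.sum_eq_zero_iff_of_nonneg fun i _ => mul_self_nonneg _] at hsum
  have hle : Submodule.span ℝ (Set.range v) ≤ LinearMap.ker (innerₛₗ ℝ x) := by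
    rw [Submodule.span_le]
    rintro _ ⟨i, rfl⟩
    simpa [real_inner_comm] using hsum i (Finset.mem_univ i)
  have hxx : x ∈ LinearMap.ker (innerₛₗ ℝ x) := hle (hv ▸ Submodule.mem_top)
  simpa using hxx

/-- A positive operator on a finite-dimensional real inner product space has a symmetric
square root. -/
lemma LinearMap.IsPositive.exists_isSymmetric_comp_self_eq {E : Type*} [NormedAddCommGroup E]
    [InnerProductSpace ℝ E] [FiniteDimensional ℝ E] {A : E →ₗ[ℝ] E} (hA : A.IsPositive) :
    ∃ T : E →ₗ[ℝ] E, T.IsSymmetric ∧ T ∘ₗ T = A := by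
  set b := hA.isSymmetric.eigenvectorBasis rfl
  set μ := hA.isSymmetric.eigenvalues rfl
  let T : E →ₗ[ℝ] E := b.toBasis.constr ℝ fun i => √(μ i) • b i
  have hT (i) : T (b i) = √(μ i) • b i := by
    rw [← b.coe_toBasis]
    exact b.toBasis.constr_basis ℝ _ i
  refine ⟨T, ?_, ?_⟩
  · have h : (innerₗ E).compl₁₂ T LinearMap.id = (innerₗ E).compl₁₂ LinearMap.id T := by
      refine LinearMap.ext_basis b.toBasis b.toBasis fun i j => ?_
      simp only [OrthonormalBasis.coe_toBasis, LinearMap.compl₁₂_apply, LinearMap.id_apply,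
        innerₗ_apply_apply, hT, real_inner_smul_left, real_inner_smul_right,
        b.inner_eq_ite]
      split_ifs with hij <;> simp [hij]
    exact fun x y => LinearMap.congr_fun₂ h x y
  · refine b.toBasis.ext fun i => ?_
    have hAi : A (b i) = μ i • b i := hA.isSymmetric.apply_eigenvectorBasis rfl i
    simp only [OrthonormalBasis.coe_toBasis, LinearMap.comp_apply, hT, map_smul, hAi, smul_smul]
    rw [Real.mul_self_sqrt (hA.nonneg_eigenvalues rfl i)]

lemma Fvol_map {n k : ℕ} (L : EuclideanSpace ℝ (Fin k) →ₗ[ℝ] EuclideanSpace ℝ (Fin k))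
    (v : Fin n → EuclideanSpace ℝ (Fin k)) :
    Fvol (fun i => L (v i)) = ENNReal.ofReal |LinearMap.det L| * Fvol v := by
  rw [Fvol, Fvol, ← Measure.addHaar_image_linearMap, LinearMap.image_convexHull, Set.image_union,
    ← Set.range_comp, ← Set.range_comp]
  simp [Function.comp_def]

/-- Every frame is the image of a uframe under an operator `T` with
`|det T| = √(det A_S)`. -/
lemma exists_isUframe_map_eq {n k : ℕ} {v : Fin n → EuclideanSpace ℝ (Fin k)}
    (hv : Submodule.span ℝ (Set.range v) = ⊤) :
    ∃ (T : EuclideanSpace ℝ (Fin k) →ₗ[ℝ] EuclideanSpace ℝ (Fin k))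
      (w : Fin n → EuclideanSpace ℝ (Fin k)), IsUframe w ∧ (∀ i, T (w i) = v i) ∧
        |LinearMap.det T| = √(LinearMap.det (frameOp v)) := by
  obtain ⟨T, hsymm, hT⟩ := (frameOp_isPositive v).exists_isSymmetric_comp_self_eq
  have hinj : Function.Injective T :=
    Function.Injective.of_comp (f := T) (by
      rw [← LinearMap.coe_comp, hT]; exact frameOp_injective hv)
  let e := LinearEquiv.ofInjectiveEndo T hinj
  have he (x) : T (e.symm x) = x := e.apply_symm_apply x
  refine ⟨T, fun i => e.symm (v i), fun x => hinj ?_, fun i => he _, ?_⟩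
  · have hinner (i) : ⟪e.symm (v i), x⟫ = ⟪v i, e.symm x⟫ := by
      conv_lhs => rw [← he x]
      rw [← hsymm, he]
    simp only [map_sum, map_smul, he, hinner]
    rw [← frameOp_apply, ← hT, LinearMap.comp_apply, he]
  · rw [← hT, LinearMap.det_comp, Real.sqrt_mul_self_eq_abs]

lemma Fvol_ne_top {n k : ℕ} (v : Fin n → EuclideanSpace ℝ (Fin k)) : Fvol v ≠ ⊤ :=
  (isBounded_convexHull.2 ((Set.finite_range v).union
    (Set.finite_range fun i => -v i)).isBounded).measure_lt_top.ne

lemma Fvol_pos {n k : ℕ} (hn : 0 < n) {v : Fin n → EuclideanSpace ℝ (Fin k)}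
    (hv : Submodule.span ℝ (Set.range v) = ⊤) : 0 < Fvol v := by
  set s := Set.range v ∪ Set.range fun i => -v i with hs
  have hzero : (0 : EuclideanSpace ℝ (Fin k)) ∈ convexHull ℝ s := by
    let i : Fin n := ⟨0, hn⟩
    have h := (convex_convexHull ℝ s).midpoint_mem (subset_convexHull ℝ s (Or.inl ⟨i, rfl⟩))
      (subset_convexHull ℝ s (Or.inr ⟨i, rfl⟩))
    simpa using h
  refine Measure.measure_pos_of_nonempty_interior _
    (interior_convexHull_nonempty_iff_affineSpan_eq_top.2 ?_)
  rw [← affineSpan_convexHull, ← Set.insert_eq_of_mem hzero, ← SetLike.coe_set_eq,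
    affineSpan_insert_zero]
  have hspan : Submodule.span ℝ (convexHull ℝ s) = ⊤ :=
    top_unique (hv ▸ Submodule.span_mono (Set.subset_union_left.trans (subset_convexHull ℝ s)))
  rw [hspan, Submodule.top_coe, AffineSubspace.top_coe]

/-- An `(n,k)`-uframe `S` is a global maximizer (resp. minimizer) of `F` over `(n,k)`-uframes
iff for every `(n,k)`-frame `S̃` one has `F(S̃)/F(S) ≤ √(det A_{S̃})` (resp. `≥`). -/
theorem uframe_max_min_iff {n k : ℕ} (hk : 0 < k) (hkn : k ≤ n)
    (v : Fin n → EuclideanSpace ℝ (Fin k)) (hv : IsUframe v) :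
    ((∀ v' : Fin n → EuclideanSpace ℝ (Fin k), IsUframe v' → Fvol v' ≤ Fvol v) ↔
      (∀ vt : Fin n → EuclideanSpace ℝ (Fin k), Submodule.span ℝ (Set.range vt) = ⊤ →
        (Fvol vt).toReal / (Fvol v).toReal ≤ Real.sqrt (LinearMap.det (frameOp vt)))) ∧
    ((∀ v' : Fin n → EuclideanSpace ℝ (Fin k), IsUframe v' → Fvol v ≤ Fvol v') ↔
      (∀ vt : Fin n → EuclideanSpace ℝ (Fin k), Submodule.span ℝ (Set.range vt) = ⊤ →
        Real.sqrt (LinearMap.det (frameOp vt)) ≤ (Fvol vt).toReal / (Fvol v).toReal)) := by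
  have hpos : 0 < (Fvol v).toReal :=
    ENNReal.toReal_pos (Fvol_pos (hk.trans_le hkn) hv.span_eq_top).ne' (Fvol_ne_top v)
  have hdet {v' : Fin n → EuclideanSpace ℝ (Fin k)} (hv' : IsUframe v') :
      √(LinearMap.det (frameOp v')) = 1 := by
    rw [hv'.frameOp_eq_id, LinearMap.det_id, Real.sqrt_one]
  have hred {vt : Fin n → EuclideanSpace ℝ (Fin k)}
      (hvt : Submodule.span ℝ (Set.range vt) = ⊤) :
      ∃ w : Fin n → EuclideanSpace ℝ (Fin k), IsUframe w ∧
        (Fvol vt).toReal = √(LinearMap.det (frameOp vt)) * (Fvol w).toReal := by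
    obtain ⟨T, w, hw, hT, hTdet⟩ := exists_isUframe_map_eq hvt
    refine ⟨w, hw, ?_⟩
    rw [← hTdet, ← funext hT, Fvol_map, ENNReal.toReal_mul, ENNReal.toReal_ofReal (abs_nonneg _)]
  refine ⟨⟨fun h vt hvt => ?_, fun h v' hv' => ?_⟩, ⟨fun h vt hvt => ?_, fun h v' hv' => ?_⟩⟩
  · obtain ⟨w, hw, hvol⟩ := hred hvt
    rw [div_le_iff₀ hpos, hvol]
    gcongr
    exacts [Fvol_ne_top v, h w hw]
  · have := h v' hv'.span_eq_top
    rwa [hdet hv', div_le_one hpos, ENNReal.toReal_le_toReal (Fvol_ne_top _) (Fvol_ne_top _)] at this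
  · obtain ⟨w, hw, hvol⟩ := hred hvt
    rw [le_div_iff₀ hpos, hvol]
    gcongr
    exacts [Fvol_ne_top w, h w hw]
  · have := h v' hv'.span_eq_top
    rwa [hdet hv', one_le_div hpos, ENNReal.toReal_le_toReal (Fvol_ne_top _) (Fvol_ne_top _)] at this
end

section
/- Let S = {v₁,…,vₙ} be an (n,k)-uframe at which the minimum of F over all (n,k)-uframes is attained. Then for all indices i, j ∈ {1,…,n} one has |vⱼ| ≤ √2·|vᵢ|. -/
open MeasureTheory
open scoped RealInnerProductSpace ENNReal

namespace IsUframe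

variable {n k : ℕ} {v : Fin n → EuclideanSpace ℝ (Fin k)}

/-- The uframe condition in matrix form: the rows `v i` have orthonormal columns. -/
theorem iff_transpose_mul_self :
    IsUframe v ↔
      (Matrix.of fun i a => v i a).transpose * (Matrix.of fun i a => v i a) = 1 := by
  constructor
  · intro h
    ext a b
    have := congrArg (fun x : EuclideanSpace ℝ (Fin k) => x a) (h (EuclideanSpace.single b 1))
    simp only [WithLp.ofLp_sum, Finset.sum_apply, PiLp.smul_apply,
      EuclideanSpace.inner_single_right] at this
    simpa [Matrix.mul_apply, Matrix.one_apply, Pi.single_apply, mul_comm] using this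
  · intro h x
    have key := congrArg (fun M => M.mulVec x.ofLp) h
    simp only [← Matrix.mulVec_mulVec, Matrix.one_mulVec] at key
    ext a
    rw [← congrFun key a]
    simp [Matrix.mulVec, dotProduct, PiLp.inner_apply, mul_comm]

theorem sum_inner_sq (hv : IsUframe v) (x : EuclideanSpace ℝ (Fin k)) :
    ∑ i, ⟪v i, x⟫ ^ 2 = ‖x‖ ^ 2 := by
  rw [← real_inner_self_eq_norm_sq]
  conv_rhs => rw [← hv x, sum_inner]
  refine Finset.sum_congr rfl fun i _ => ?_
  rw [real_inner_smul_left, hv x, sq]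

theorem norm_sq_le_one (hv : IsUframe v) (j : Fin n) : ‖v j‖ ^ 2 ≤ 1 := by
  have h : ⟪v j, v j⟫ ^ 2 ≤ ‖v j‖ ^ 2 := by
    rw [← hv.sum_inner_sq (v j)]
    exact Finset.single_le_sum (f := fun i => ⟪v i, v j⟫ ^ 2)
      (fun i _ => sq_nonneg _) (Finset.mem_univ j)
  rw [real_inner_self_eq_norm_sq] at h
  nlinarith [sq_nonneg ‖v j‖]

theorem span_eq_top_s12 (hv : IsUframe v) : Submodule.span ℝ (Set.range v) = ⊤ := by
  refine Submodule.eq_top_iff'.2 fun x => ?_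
  rw [← hv x]
  exact Submodule.sum_mem _ fun i _ =>
    Submodule.smul_mem _ _ (Submodule.subset_span (Set.mem_range_self i))

theorem Fvol_pos (hn : 0 < n) (hv : IsUframe v) : 0 < Fvol v := by
  let s := Set.range v ∪ Set.range fun i => -v i
  have h0 : (0 : EuclideanSpace ℝ (Fin k)) ∈ affineSpan ℝ s := by
    have := (convex_convexHull ℝ s).midpoint_mem
      (subset_convexHull ℝ s (Or.inl ⟨⟨0, hn⟩, rfl⟩))
      (subset_convexHull ℝ s (Or.inr ⟨⟨0, hn⟩, rfl⟩))
    rw [midpoint_self_neg] at this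
    exact convexHull_subset_affineSpan s this
  have htop : affineSpan ℝ s = ⊤ := by
    refine SetLike.coe_injective ?_
    rw [← affineSpan_insert_eq_affineSpan ℝ h0, affineSpan_insert_zero, Submodule.span_union,
      hv.span_eq_top_s12, top_sup_eq]
    simp
  have hint : (interior (convexHull ℝ s)).Nonempty :=
    interior_convexHull_nonempty_iff_affineSpan_eq_top.2 htop
  exact (isOpen_interior.measure_pos volume hint).trans_le (measure_mono interior_subset)

end IsUframe

section Fvol

variable {n k : ℕ}

theorem Fvol_lt_top (v : Fin n → EuclideanSpace ℝ (Fin k)) : Fvol v < ⊤ :=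
  (isBounded_convexHull.2
    ((Set.finite_range v).union (Set.finite_range _)).isBounded).measure_lt_top

theorem Fvol_linearMap (T : EuclideanSpace ℝ (Fin k) →ₗ[ℝ] EuclideanSpace ℝ (Fin k))
    (v : Fin n → EuclideanSpace ℝ (Fin k)) :
    Fvol (fun i => T (v i)) = ENNReal.ofReal |LinearMap.det T| * Fvol v := by
  rw [Fvol, Fvol, ← Measure.addHaar_image_linearMap, T.image_convexHull, Set.image_union,
    ← Set.range_comp, ← Set.range_comp]
  simp [Function.comp_def]

theorem Fvol_update_le (v : Fin n → EuclideanSpace ℝ (Fin k)) (i j : Fin n) :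
    Fvol (Function.update v i (v j)) ≤ Fvol v := by
  have h : ∀ l, Function.update v i (v j) l ∈ Set.range v := fun l => by
    obtain rfl | hl := eq_or_ne l i
    · simp
    · simp [hl]
  refine measure_mono (convexHull_mono (Set.union_subset_union ?_ ?_))
  · rintro _ ⟨l, rfl⟩
    exact h l
  · rintro _ ⟨l, rfl⟩
    obtain ⟨m, hm⟩ := h l
    exact ⟨m, congrArg Neg.neg hm⟩

open scoped MatrixOrder Matrix.Norms.L2Operator in
/-- If `v` minimizes `Fvol` over uframes and the frame operator of `w` has determinant greater
than `1`, then normalizing `w` to a uframe shows `Fvol v < Fvol w`. -/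
theorem Fvol_lt_of_one_lt_det {v w : Fin n → EuclideanSpace ℝ (Fin k)} (hpos : 0 < Fvol v)
    (hmin : ∀ v' : Fin n → EuclideanSpace ℝ (Fin k), IsUframe v' → Fvol v ≤ Fvol v')
    (hdet : 1 < ((Matrix.of fun i a => w i a).transpose * (Matrix.of fun i a => w i a)).det) :
    Fvol v < Fvol w := by
  set W : Matrix (Fin n) (Fin k) ℝ := Matrix.of fun i a => w i a with hW
  have hpsd : (W.transpose * W).PosSemidef := by
    simpa using Matrix.posSemidef_conjTranspose_mul_self W
  obtain ⟨B, hB⟩ : ∃ B : Matrix (Fin k) (Fin k) ℝ, W.transpose * W = B.transpose * B := by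
    obtain ⟨B, hB⟩ := CStarAlgebra.nonneg_iff_eq_star_mul_self.1 hpsd.nonneg
    exact ⟨B, by simpa [Matrix.star_eq_conjTranspose] using hB⟩
  have hBdet : 1 < |B.det| := by
    rw [hB, Matrix.det_mul, Matrix.det_transpose, ← sq] at hdet
    exact (one_lt_sq_iff_one_lt_abs _).1 hdet
  have hBu : IsUnit B.det := by
    refine isUnit_iff_ne_zero.2 fun h => ?_
    norm_num [h] at hBdet
  let T := Matrix.toEuclideanLin (B⁻¹).transpose
  have hframe : IsUframe fun i => T (w i) := by
    have hTW : (Matrix.of fun i a => T (w i) a) = W * B⁻¹ := by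
      ext i a
      simp [T, hW, Matrix.mul_apply, Matrix.mulVec, dotProduct, mul_comm]
    rw [IsUframe.iff_transpose_mul_self, hTW, Matrix.transpose_mul, Matrix.mul_assoc,
      ← Matrix.mul_assoc _ W, hB, Matrix.mul_assoc, Matrix.mul_nonsing_inv _ hBu,
      Matrix.mul_one, ← Matrix.transpose_mul, Matrix.mul_nonsing_inv _ hBu,
      Matrix.transpose_one]
  have hT : |LinearMap.det T| < 1 := by
    have : LinearMap.det T = (B.det)⁻¹ := by
      simp [T, LinearMap.det_toLpLin, Matrix.det_nonsing_inv]
    rw [this, abs_inv]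
    exact inv_lt_one_of_one_lt₀ hBdet
  have hle := hmin _ hframe
  rw [Fvol_linearMap] at hle
  have hw0 : Fvol w ≠ 0 := fun h => by
    rw [h, mul_zero] at hle
    exact hpos.not_ge hle
  refine hle.trans_lt ?_
  conv_rhs => rw [← one_mul (Fvol w)]
  exact ENNReal.mul_lt_mul_left hw0 (Fvol_lt_top w).ne (ENNReal.ofReal_lt_one.2 hT)

end Fvol

/-- The determinant of the frame operator after replacing `v i` by `v j` in a uframe. -/
theorem IsUframe.det_update {n k : ℕ} {v : Fin n → EuclideanSpace ℝ (Fin k)} (hv : IsUframe v)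
    (i j : Fin n) :
    ((Matrix.of fun l a => Function.update v i (v j) l a).transpose *
        (Matrix.of fun l a => Function.update v i (v j) l a)).det =
      (1 - ‖v i‖ ^ 2) * (1 + ‖v j‖ ^ 2) + ⟪v i, v j⟫ ^ 2 := by
  let U : Matrix (Fin k) (Fin 2) ℝ := Matrix.of fun a => ![-v i a, v j a]
  let C : Matrix (Fin 2) (Fin k) ℝ := Matrix.of ![fun a => v i a, fun a => v j a]
  have hM : (Matrix.of fun l a => Function.update v i (v j) l a).transpose *
        (Matrix.of fun l a => Function.update v i (v j) l a) = 1 + U * C := by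
    rw [← IsUframe.iff_transpose_mul_self.1 hv]
    ext a b
    simp only [Matrix.mul_apply, Matrix.transpose_apply, Matrix.of_apply, Matrix.add_apply]
    rw [← Finset.add_sum_erase _ _ (Finset.mem_univ i),
      ← Finset.add_sum_erase _ (fun l => v l a * v l b) (Finset.mem_univ i),
      Finset.sum_congr rfl (g := fun l => v l a * v l b) fun l hl => by
        rw [Function.update_of_ne (Finset.ne_of_mem_erase hl)]]
    simp [U, C]
    ring
  have hCU : 1 + C * U =
      !![1 - ‖v i‖ ^ 2, ⟪v i, v j⟫; -⟪v i, v j⟫, 1 + ‖v j‖ ^ 2] := by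
    simp only [EuclideanSpace.real_norm_sq_eq]
    ext a b
    fin_cases a <;> fin_cases b <;>
      simp [U, C, Matrix.vecMul, dotProduct, PiLp.inner_apply,
        sq, mul_comm, sub_eq_add_neg]
  rw [hM, Matrix.det_one_add_mul_comm, hCU, Matrix.det_fin_two_of]
  ring

/-- If the minimum of `F` over all `(n,k)`-uframes is attained at `S = {v₁,…,vₙ}`, then
`|vⱼ| ≤ √2·|vᵢ|` for all indices `i, j`. -/
theorem min_uframe_norm_ratio {n k : ℕ} (hk : 0 < k) (hkn : k ≤ n)
    (v : Fin n → EuclideanSpace ℝ (Fin k)) (hv : IsUframe v)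
    (hmin : ∀ v' : Fin n → EuclideanSpace ℝ (Fin k), IsUframe v' → Fvol v ≤ Fvol v') :
    ∀ i j, ‖v j‖ ≤ Real.sqrt 2 * ‖v i‖ := by
  intro i j
  have hdet : (1 - ‖v i‖ ^ 2) * (1 + ‖v j‖ ^ 2) + ⟪v i, v j⟫ ^ 2 ≤ 1 := by
    rw [← hv.det_update i j]
    by_contra! h
    exact (Fvol_lt_of_one_lt_det (hv.Fvol_pos (hk.trans_le hkn)) hmin h).not_ge
      (Fvol_update_le v i j)
  have hj := hv.norm_sq_le_one j
  refine abs_le_of_sq_le_sq' ?_ (by positivity) |>.2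
  rw [mul_pow, Real.sq_sqrt zero_le_two]
  rcases le_total (‖v i‖ ^ 2) (1 / 2) with h | h
  · nlinarith [sq_nonneg ⟪v i, v j⟫, sq_nonneg ‖v j‖]
  · linarith
end

section
/- Let V(n,k) denote the supremum of F(S) over all (n,k)-uframes S. Then for all n > k ≥ 2, V(n,k) ≥ (2/k)·V(n−1, k−1). -/
open MeasureTheory
open scoped RealInnerProductSpace ENNReal

/-- `V(n,k)`: the supremum of `F(S)` over all `(n,k)`-uframes `S`. -/
noncomputable def Vmax (n k : ℕ) : ℝ≥0∞ :=
  ⨆ (v : Fin n → EuclideanSpace ℝ (Fin k)) (_ : IsUframe v), Fvol v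

/-- The point of `ℝʲ⁺¹` with first coordinate `t` and remaining coordinates `x`. -/
noncomputable def euclideanCons {j : ℕ} (t : ℝ) (x : EuclideanSpace ℝ (Fin j)) :
    EuclideanSpace ℝ (Fin (j + 1)) :=
  WithLp.toLp 2 (Fin.cons t x.ofLp)

theorem euclideanCons_add {j : ℕ} (s t : ℝ) (x y : EuclideanSpace ℝ (Fin j)) :
    euclideanCons (s + t) (x + y) = euclideanCons s x + euclideanCons t y := by
  ext i
  refine Fin.cases ?_ (fun i => ?_) i <;> simp [euclideanCons]

theorem euclideanCons_smul {j : ℕ} (c t : ℝ) (x : EuclideanSpace ℝ (Fin j)) :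
    euclideanCons (c * t) (c • x) = c • euclideanCons t x := by
  ext i
  refine Fin.cases ?_ (fun i => ?_) i <;> simp [euclideanCons]

/-- The inclusion of `ℝʲ` into `ℝʲ⁺¹` as the hyperplane of vanishing first coordinate. -/
noncomputable def euclideanConsZero (j : ℕ) :
    EuclideanSpace ℝ (Fin j) →ₗ[ℝ] EuclideanSpace ℝ (Fin (j + 1)) where
  toFun x := euclideanCons 0 x
  map_add' x y := by simpa using euclideanCons_add 0 0 x y
  map_smul' c x := by simpa using euclideanCons_smul c 0 x

theorem measurePreserving_euclideanCons (j : ℕ) :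
    MeasurePreserving (fun p : ℝ × EuclideanSpace ℝ (Fin j) => euclideanCons p.1 p.2) := by
  have h1 := (MeasurePreserving.id (volume : Measure ℝ)).prod
    (PiLp.volume_preserving_ofLp (Fin j))
  have h2 := (volume_preserving_piFinSuccAbove (fun _ : Fin (j + 1) => ℝ) 0).symm
  have h3 := (PiLp.volume_preserving_toLp (Fin (j + 1))).comp (h2.comp h1)
  rw [← Measure.volume_eq_prod] at h3
  convert h3 using 1
  ext p i
  refine Fin.cases ?_ (fun i => ?_) i <;>
    simp [euclideanCons, MeasurableEquiv.piFinSuccAbove]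

/-- The uframe in `ℝʲ⁺¹` obtained by adding a unit vector orthogonal to `ℝʲ`. -/
noncomputable def suspendFrame {m j : ℕ} (v : Fin m → EuclideanSpace ℝ (Fin j)) :
    Fin (m + 1) → EuclideanSpace ℝ (Fin (j + 1)) :=
  Fin.cons (euclideanCons 1 0) fun i => euclideanCons 0 (v i)

theorem IsUframe.suspendFrame {m j : ℕ} {v : Fin m → EuclideanSpace ℝ (Fin j)}
    (hv : IsUframe v) : IsUframe (suspendFrame v) := by
  intro x
  obtain ⟨t, y, rfl⟩ : ∃ t y, x = euclideanCons t y := by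
    refine ⟨x 0, WithLp.toLp 2 (Fin.tail x.ofLp), ?_⟩
    ext i
    refine Fin.cases ?_ (fun i => ?_) i <;> simp [euclideanCons]
  have hin (s t : ℝ) (x y : EuclideanSpace ℝ (Fin j)) :
      ⟪euclideanCons s x, euclideanCons t y⟫ = s * t + ⟪x, y⟫ := by
    simp [euclideanCons, PiLp.inner_apply, Fin.sum_univ_succ, mul_comm]
  have hsum : ∑ i, ⟪v i, y⟫ • euclideanCons 0 (v i) = euclideanCons 0 y := by
    change ∑ i, ⟪v i, y⟫ • euclideanConsZero j (v i) = euclideanConsZero j y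
    simp_rw [← map_smul, ← map_sum]
    rw [hv y]
  simp only [_root_.suspendFrame, Fin.sum_univ_succ, Fin.cons_zero, Fin.cons_succ, hin]
  simp only [zero_mul, zero_add, one_mul, inner_zero_left, add_zero, hsum]
  rw [← euclideanCons_smul, ← euclideanCons_add, mul_one, smul_zero, zero_add, add_zero]

theorem euclideanCons_smul_mem_convexHull {m j : ℕ} (v : Fin m → EuclideanSpace ℝ (Fin j))
    {t : ℝ} (ht : t ∈ Set.Icc (-1 : ℝ) 1) {x : EuclideanSpace ℝ (Fin j)}
    (hx : x ∈ convexHull ℝ (Set.range v ∪ Set.range fun i => -v i)) :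
    euclideanCons t ((1 - |t|) • x) ∈
      convexHull ℝ (Set.range (suspendFrame v) ∪ Set.range fun i => -suspendFrame v i) := by
  set C := convexHull ℝ (Set.range (suspendFrame v) ∪ Set.range fun i => -suspendFrame v i)
    with hC
  have hpos (i) : suspendFrame v i ∈ C := subset_convexHull ℝ _ (Or.inl ⟨i, rfl⟩)
  have hneg (i) : -suspendFrame v i ∈ C := subset_convexHull ℝ _ (Or.inr ⟨i, rfl⟩)
  have hconv : Convex ℝ C := convex_convexHull ℝ _
  have hbase : euclideanConsZero j x ∈ C := by
    have hsub : convexHull ℝ (Set.range v ∪ Set.range fun i => -v i) ⊆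
        euclideanConsZero j ⁻¹' C := by
      refine convexHull_min ?_ (hconv.linear_preimage _)
      rintro _ (⟨i, rfl⟩ | ⟨i, rfl⟩)
      · exact hpos i.succ
      · rw [Set.mem_preimage, map_neg]
        exact hneg i.succ
    exact hsub hx
  have habs : |t| ≤ 1 := abs_le.2 ht
  obtain ⟨a, ha, hta⟩ : ∃ a : ℝ, euclideanCons a 0 ∈ C ∧ |t| * a = t := by
    rcases le_total 0 t with h | h
    · exact ⟨1, by simpa [suspendFrame] using hpos 0, by simp [abs_of_nonneg h]⟩
    · refine ⟨-1, ?_, by simp [abs_of_nonpos h]⟩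
      have := euclideanCons_smul (-1) 1 (0 : EuclideanSpace ℝ (Fin j))
      have h0 := hneg 0
      simp only [mul_one, smul_zero, neg_smul, one_smul] at this
      rw [this]
      simpa [suspendFrame] using h0
  have := hconv hbase ha (sub_nonneg.2 habs) (abs_nonneg t) (by ring)
  change (1 - |t|) • euclideanCons 0 x + _ ∈ C at this
  rwa [← euclideanCons_smul, ← euclideanCons_smul, ← euclideanCons_add, hta, smul_zero,
    mul_zero, zero_add, add_zero] at this

theorem integral_one_sub_abs_pow (j : ℕ) :
    ∫ t in (-1 : ℝ)..1, (1 - |t|) ^ j = 2 / ((j : ℝ) + 1) := by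
  have hc : Continuous fun t : ℝ => (1 - |t|) ^ j := by fun_prop
  rw [← intervalIntegral.integral_add_adjacent_intervals (b := 0)
    (hc.intervalIntegrable _ _) (hc.intervalIntegrable _ _)]
  have h1 : ∫ t in (-1 : ℝ)..0, (1 - |t|) ^ j = ∫ t in (-1 : ℝ)..0, (1 + t) ^ j := by
    refine intervalIntegral.integral_congr fun t ht => ?_
    rw [Set.uIcc_of_le (by norm_num)] at ht
    simp [abs_of_nonpos ht.2]
  have h2 : ∫ t in (0 : ℝ)..1, (1 - |t|) ^ j = ∫ t in (0 : ℝ)..1, (1 - t) ^ j := by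
    refine intervalIntegral.integral_congr fun t ht => ?_
    rw [Set.uIcc_of_le (by norm_num)] at ht
    simp [abs_of_nonneg ht.1]
  rw [h1, h2, intervalIntegral.integral_comp_add_left (fun t => t ^ j),
    intervalIntegral.integral_comp_sub_left (fun t => t ^ j)]
  norm_num [integral_pow]
  ring

theorem lintegral_one_sub_abs_pow (j : ℕ) :
    ∫⁻ t in Set.Icc (-1 : ℝ) 1, ENNReal.ofReal |(1 - |t|) ^ j| = 2 / ((j + 1 : ℕ) : ℝ≥0∞) := by
  have hc : Continuous fun t : ℝ => (1 - |t|) ^ j := by fun_prop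
  have hcongr : ∫⁻ t in Set.Icc (-1 : ℝ) 1, ENNReal.ofReal |(1 - |t|) ^ j| =
      ∫⁻ t in Set.Icc (-1 : ℝ) 1, ENNReal.ofReal ((1 - |t|) ^ j) := by
    refine setLIntegral_congr_fun measurableSet_Icc fun t ht => ?_
    have : |t| ≤ 1 := abs_le.2 ht
    rw [abs_of_nonneg (pow_nonneg (sub_nonneg.2 this) j)]
  rw [hcongr, ← ofReal_integral_eq_lintegral_ofReal hc.integrableOn_Icc,
    integral_Icc_eq_integral_Ioc, ← intervalIntegral.integral_of_le (by norm_num),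
    integral_one_sub_abs_pow, ENNReal.ofReal_div_of_pos (by positivity)]
  · congr 1
    · simp
    · rw [← Nat.cast_succ, ENNReal.ofReal_natCast]
  · filter_upwards [ae_restrict_mem measurableSet_Icc] with t ht
    exact pow_nonneg (sub_nonneg.2 (abs_le.2 ht)) j

theorem mul_Fvol_le_Fvol_suspendFrame {m j : ℕ} (v : Fin m → EuclideanSpace ℝ (Fin j)) :
    2 / ((j + 1 : ℕ) : ℝ≥0∞) * Fvol v ≤ Fvol (suspendFrame v) := by
  have hmeas : MeasurableSet
      (convexHull ℝ (Set.range (suspendFrame v) ∪ Set.range fun i => -suspendFrame v i)) :=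
    (((Set.finite_range _).union (Set.finite_range _)).isCompact_convexHull ℝ)
      |>.isClosed.measurableSet
  have hmp := measurePreserving_euclideanCons j
  rw [Fvol, Fvol, ← hmp.measure_preimage hmeas.nullMeasurableSet, Measure.volume_eq_prod,
    Measure.prod_apply (hmp.measurable hmeas), ← lintegral_one_sub_abs_pow,
    ← lintegral_mul_const _ (by fun_prop)]
  refine le_trans (setLIntegral_mono' measurableSet_Icc fun t ht => ?_)
    (setLIntegral_le_lintegral (Set.Icc (-1 : ℝ) 1) _)
  have hs := Measure.addHaar_smul (volume : Measure (EuclideanSpace ℝ (Fin j))) (1 - |t|)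
    (convexHull ℝ (Set.range v ∪ Set.range fun i => -v i))
  rw [finrank_euclideanSpace_fin] at hs
  rw [← hs]
  refine measure_mono ?_
  rintro _ ⟨x, hx, rfl⟩
  exact euclideanCons_smul_mem_convexHull v ht hx

/-- For all `n > k ≥ 2`, `V(n,k) ≥ (2/k)·V(n−1, k−1)`. -/
theorem Vmax_ge (n k : ℕ) (hk : 2 ≤ k) (hkn : k < n) :
    (2 / (k : ℝ≥0∞)) * Vmax (n - 1) (k - 1) ≤ Vmax n k := by
  obtain ⟨j, rfl⟩ : ∃ j, k = j + 1 := ⟨k - 1, by omega⟩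
  obtain ⟨m, rfl⟩ : ∃ m, n = m + 1 := ⟨n - 1, by omega⟩
  simp only [Vmax, ENNReal.mul_iSup]
  refine iSup₂_le fun v hv => ?_
  exact (mul_Fvol_le_Fvol_suspendFrame v).trans (le_iSup₂_of_le _ hv.suspendFrame le_rfl)
end

section
/- Let R be a finite centrally symmetric set of vectors in ℝᵏ (i.e., R = −R) and let v ∈ ℝᵏ. Then the function λ ↦ vol(conv(R ∪ {λv, −λv})) is a convex function of λ on ℝ. -/
open MeasureTheory
open scoped ENNReal

/-- A subset of a weighted Minkowski sum of two compact intervals is at most as long as the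
weighted sum of their lengths. -/
lemma Real.volume_le_of_subset_combination {A B C : Set ℝ} (hB : IsCompact B) (hBc : Convex ℝ B)
    (hC : IsCompact C) (hCc : Convex ℝ C) {a b : ℝ} (ha : 0 ≤ a) (hb : 0 ≤ b)
    (h : ∀ t ∈ A, ∃ x ∈ B, ∃ y ∈ C, t = a * x + b * y) :
    volume A ≤ ENNReal.ofReal a * volume B + ENNReal.ofReal b * volume C := by
  rcases A.eq_empty_or_nonempty with rfl | ⟨t, ht⟩
  · simp
  obtain ⟨x, hx, y, hy, -⟩ := h t ht
  have hBI := eq_Icc_of_connected_compact ⟨⟨x, hx⟩, hBc.isPreconnected⟩ hB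
  have hCI := eq_Icc_of_connected_compact ⟨⟨y, hy⟩, hCc.isPreconnected⟩ hC
  generalize sInf B = b₁ at hBI
  generalize sSup B = b₂ at hBI
  generalize sInf C = c₁ at hCI
  generalize sSup C = c₂ at hCI
  subst hBI hCI
  have hb12 : b₁ ≤ b₂ := hx.1.trans hx.2
  have hc12 : c₁ ≤ c₂ := hy.1.trans hy.2
  have hA : A ⊆ Set.Icc (a * b₁ + b * c₁) (a * b₂ + b * c₂) := by
    intro s hs
    obtain ⟨x, hx, y, hy, rfl⟩ := h s hs
    constructor
    · gcongr
      exacts [hx.1, hy.1]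
    · gcongr
      exacts [hx.2, hy.2]
  refine (measure_mono hA).trans_eq ?_
  rw [Real.volume_Icc, Real.volume_Icc, Real.volume_Icc, ← ENNReal.ofReal_mul ha,
    ← ENNReal.ofReal_mul hb, ← ENNReal.ofReal_add (mul_nonneg ha (sub_nonneg.2 hb12))
      (mul_nonneg hb (sub_nonneg.2 hc12))]
  congr 1
  ring

section ShadowSystem

variable {E : Type*} [NormedAddCommGroup E] [NormedSpace ℝ E]

/-- The linear map `(x, s) ↦ x + (r s) v`, whose images of a fixed convex set, as `r` varies,
form a shadow system in the direction `v`. -/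
def shadowMap (v : E) (r : ℝ) : E × ℝ →ₗ[ℝ] E :=
  LinearMap.fst ℝ E ℝ + r • (LinearMap.snd ℝ E ℝ).smulRight v

@[simp]
lemma shadowMap_apply (v : E) (r : ℝ) (p : E × ℝ) : shadowMap v r p = p.1 + r • p.2 • v := by
  simp [shadowMap]

lemma continuous_shadowMap (v : E) (r : ℝ) : Continuous (shadowMap v r) := by
  have : ⇑(shadowMap v r) = fun p => p.1 + r • p.2 • v := funext (shadowMap_apply v r)
  rw [this]
  fun_prop

variable [MeasurableSpace E] [BorelSpace E]

/-- Fubini's theorem for a Haar measure along a splitting of the space as `ℝ × F`, up to a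
constant factor. -/
lemma exists_measure_eq_mul_lintegral_slice (μ : Measure E) [μ.IsAddHaarMeasure]
    {F : Type*} [NormedAddCommGroup F] [NormedSpace ℝ F] [FiniteDimensional ℝ F]
    [MeasurableSpace F] [BorelSpace F] (e : E ≃L[ℝ] ℝ × F) (ν : Measure F) [ν.IsAddHaarMeasure] :
    ∃ c : ℝ≥0∞, ∀ K : Set E, MeasurableSet K →
      μ K = c * ∫⁻ y, volume {t : ℝ | e.symm (t, y) ∈ K} ∂ν := by
  have hμ : (μ.map e).IsAddHaarMeasure := e.isAddHaarMeasure_map μ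
  refine ⟨(Measure.addHaarScalarFactor (μ.map e) (volume.prod ν) : ℝ≥0∞), fun K hK => ?_⟩
  have hK' : MeasurableSet (e.symm ⁻¹' K) := e.symm.continuous.measurable hK
  have h := congrArg (fun m : Measure (ℝ × F) => m (e.symm ⁻¹' K))
    (Measure.isAddLeftInvariant_eq_smul (μ.map e) (volume.prod ν))
  simp only [Measure.smul_apply, Measure.map_apply e.continuous.measurable hK'] at h
  rw [Measure.prod_apply_symm hK', ← Set.preimage_comp, e.symm_comp_self, Set.preimage_id] at h
  exact h

/-- The volume of a shadow system is a convex function of its parameter. -/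
theorem convexOn_measure_shadowMap_image [FiniteDimensional ℝ E] (μ : Measure E)
    [μ.IsAddHaarMeasure] (v : E)
    {C : Set (E × ℝ)} (hC : IsCompact C) (hCc : Convex ℝ C) :
    ConvexOn ℝ Set.univ (fun r : ℝ => (μ (shadowMap v r '' C)).toReal) := by
  rcases eq_or_ne v 0 with rfl | hv
  · have : ∀ r : ℝ, shadowMap (0 : E) r = shadowMap 0 0 := fun r => by
      ext <;> simp
    simp only [this]
    exact convexOn_const _ convex_univ
  obtain ⟨f, hf⟩ := SeparatingDual.exists_eq_one (R := ℝ) hv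
  let e : E ≃L[ℝ] ℝ × f.ker :=
    ContinuousLinearEquiv.equivOfRightInverse f (ContinuousLinearMap.toSpanSingleton ℝ v)
      fun t => by simp [hf]
  have he : ∀ t y, e.symm (t, y) = t • v + y := fun t y => by
    simp [e]
  have hK : ∀ r, IsCompact (shadowMap v r '' C) := fun r => hC.image (continuous_shadowMap v r)
  have hKc : ∀ r, Convex ℝ (shadowMap v r '' C) := fun r => hCc.linear_image _
  obtain ⟨c, hc⟩ := exists_measure_eq_mul_lintegral_slice μ e Measure.addHaar
  have hT : ∀ r y, IsCompact {t : ℝ | e.symm (t, y) ∈ shadowMap v r '' C} := fun r y => by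
    refine ((hK r).image (continuous_fst.comp e.continuous)).of_isClosed_subset
      ((hK r).isClosed.preimage (by fun_prop)) fun t ht => ⟨_, ht, ?_⟩
    simp
  have hTc : ∀ r y, Convex ℝ {t : ℝ | e.symm (t, y) ∈ shadowMap v r '' C} := fun r y => by
    intro t ht u hu a b ha hb hab
    have := hKc r ht hu ha hb hab
    rwa [← map_smul, ← map_smul, ← map_add, Prod.smul_mk, Prod.smul_mk, Prod.mk_add_mk,
      ← add_smul, hab, one_smul] at this
  refine ⟨convex_univ, fun r _ s _ a b ha hb hab => ?_⟩
  have key : μ (shadowMap v (a • r + b • s) '' C) ≤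
      ENNReal.ofReal a * μ (shadowMap v r '' C) + ENNReal.ofReal b * μ (shadowMap v s '' C) := by
    have hm : ∀ r, Measurable fun y => volume {t : ℝ | e.symm (t, y) ∈ shadowMap v r '' C} :=
      fun r => measurable_measure_prodMk_right (e.symm.continuous.measurable (hK r).measurableSet)
    rw [hc _ (hK _).measurableSet, hc _ (hK r).measurableSet, hc _ (hK s).measurableSet,
      mul_left_comm, mul_left_comm (ENNReal.ofReal b), ← mul_add,
      ← lintegral_const_mul _ (hm r), ← lintegral_const_mul _ (hm s),
      ← lintegral_add_left ((hm r).const_mul _)]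
    gcongr with y
    refine Real.volume_le_of_subset_combination (hT r y) (hTc r y) (hT s y) (hTc s y) ha hb ?_
    rintro t ⟨p, hp, hpt⟩
    rw [shadowMap_apply, he] at hpt
    refine ⟨t + (r - (a * r + b * s)) * p.2, ⟨p, hp, ?_⟩,
      t + (s - (a * r + b * s)) * p.2, ⟨p, hp, ?_⟩, ?_⟩
    · rw [shadowMap_apply, he, ← sub_eq_zero]
      rw [← sub_eq_zero] at hpt
      rw [← hpt, smul_eq_mul, smul_eq_mul]
      module
    · rw [shadowMap_apply, he, ← sub_eq_zero]
      rw [← sub_eq_zero] at hpt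
      rw [← hpt, smul_eq_mul, smul_eq_mul]
      module
    · obtain rfl : b = 1 - a := by linarith
      ring
  have hr := (hK r).measure_lt_top (μ := μ) |>.ne
  have hs := (hK s).measure_lt_top (μ := μ) |>.ne
  have hfin := ENNReal.toReal_mono (by finiteness) key
  rwa [ENNReal.toReal_add (by finiteness) (by finiteness), ENNReal.toReal_mul, ENNReal.toReal_mul,
    ENNReal.toReal_ofReal ha, ENNReal.toReal_ofReal hb] at hfin

end ShadowSystem

/-- For a finite centrally symmetric set `R` of vectors in `ℝᵏ` and a vector `v`, the
function `λ ↦ vol(conv(R ∪ {λv, −λv}))` is convex on `ℝ`. -/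
theorem vol_convexHull_scaled_vertex_convexOn {k : ℕ}
    (R : Set (EuclideanSpace ℝ (Fin k))) (hRfin : R.Finite) (hRsym : R = -R)
    (v : EuclideanSpace ℝ (Fin k)) :
    ConvexOn ℝ Set.univ (fun lam : ℝ =>
      (volume (convexHull ℝ (R ∪ {lam • v, -(lam • v)}))).toReal) := by
  have hfin : ((fun x => (x, (0 : ℝ))) '' R ∪ {(0, 1), (0, -1)}).Finite :=
    (hRfin.image _).union (Set.toFinite _)
  convert convexOn_measure_shadowMap_image volume v (hfin.isCompact_convexHull ℝ)
    (convex_convexHull ℝ _) using 5 with r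
  rw [LinearMap.image_convexHull, Set.image_union, Set.image_image, Set.image_pair]
  simp
end

section
/- Let W = {w₁, w₂, w₃} ⊂ ℝ² with wⱼ₊₁ = √(2/3)·(cos(jπ/3), sin(jπ/3)) for j = 0, 1, 2. Then W is a (3,2)-uframe, conv{±w₁, ±w₂, ±w₃} is a regular hexagon, and W is a local maximum of F on the set of (3,2)-uframes: there exists ε > 0 such that every (3,2)-uframe S = {v₁, v₂, v₃} with |vᵢ − wᵢ| < ε for i = 1, 2, 3 satisfies F(S) ≤ F(W). -/
open MeasureTheory Real
open scoped RealInnerProductSpace ENNReal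

/-- The vector `(a, b)` in the Euclidean plane. -/
noncomputable def planeVec (a b : ℝ) : EuclideanSpace ℝ (Fin 2) :=
  (WithLp.equiv 2 (Fin 2 → ℝ)).symm ![a, b]

/-- A subset of the plane is a regular hexagon if it is the convex hull of six points
equally spaced (at angles `θ + jπ/3`) on a circle of some radius `r > 0` about some
center `c`. -/
def IsRegularHexagon (P : Set (EuclideanSpace ℝ (Fin 2))) : Prop :=
  ∃ (c : EuclideanSpace ℝ (Fin 2)) (r θ : ℝ), 0 < r ∧
    P = convexHull ℝ (Set.range fun j : Fin 6 =>
      c + r • planeVec (Real.cos (θ + j * π / 3)) (Real.sin (θ + j * π / 3)))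

/-- The signed area of the parallelogram spanned by `u` and `v`. -/
def cross (u v : EuclideanSpace ℝ (Fin 2)) : ℝ := u 0 * v 1 - u 1 * v 0

/-- The linear map sending the standard basis of the plane to `u`, `v`. -/
noncomputable def frameMap (u v : EuclideanSpace ℝ (Fin 2)) :
    EuclideanSpace ℝ (Fin 2) →ₗ[ℝ] EuclideanSpace ℝ (Fin 2) :=
  Matrix.toLpLin 2 2 !![u 0, v 0; u 1, v 1]

theorem frameMap_apply (u v x : EuclideanSpace ℝ (Fin 2)) :
    frameMap u v x = x 0 • u + x 1 • v := by
  ext i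
  fin_cases i <;> simp [frameMap, Matrix.toLpLin_apply, dotProduct, mul_comm]

theorem volume_image_frameMap (u v : EuclideanSpace ℝ (Fin 2))
    (s : Set (EuclideanSpace ℝ (Fin 2))) :
    volume (frameMap u v '' s) = ENNReal.ofReal |cross u v| * volume s := by
  rw [Measure.addHaar_image_linearMap, frameMap, LinearMap.det_toLpLin, Matrix.det_fin_two_of,
    cross, mul_comm (v 0)]

/-- The triangle with vertices `0`, `(1, 0)`, `(0, 1)`. -/
def unitTriangle : Set (EuclideanSpace ℝ (Fin 2)) := {x | 0 ≤ x 0 ∧ 0 ≤ x 1 ∧ x 0 + x 1 ≤ 1}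

/-- The open unit square. -/
def unitSquare : Set (EuclideanSpace ℝ (Fin 2)) := {x | ∀ i, x i ∈ Set.Ioo (0 : ℝ) 1}

theorem volume_prod_triangle :
    volume {p : ℝ × ℝ | 0 ≤ p.1 ∧ 0 ≤ p.2 ∧ p.1 + p.2 ≤ 1} = ENNReal.ofReal (1 / 2) := by
  have hm : MeasurableSet {p : ℝ × ℝ | 0 ≤ p.1 ∧ 0 ≤ p.2 ∧ p.1 + p.2 ≤ 1} := by
    measurability
  have hslice : ∀ x : ℝ, volume (Prod.mk x ⁻¹' {p : ℝ × ℝ | 0 ≤ p.1 ∧ 0 ≤ p.2 ∧ p.1 + p.2 ≤ 1}) =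
      (Set.Icc (0 : ℝ) 1).indicator (fun x => ENNReal.ofReal (1 - x)) x := by
    intro x
    by_cases hx : x ∈ Set.Icc (0 : ℝ) 1
    · have : Prod.mk x ⁻¹' {p : ℝ × ℝ | 0 ≤ p.1 ∧ 0 ≤ p.2 ∧ p.1 + p.2 ≤ 1} =
          Set.Icc 0 (1 - x) := by
        ext y
        simp only [Set.mem_preimage, Set.mem_ofPred_eq, Set.mem_Icc]
        exact ⟨fun h => ⟨h.2.1, by linarith⟩, fun h => ⟨hx.1, h.1, by linarith⟩⟩
      rw [this, Set.indicator_of_mem hx, Real.volume_Icc, sub_zero]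
    · have : Prod.mk x ⁻¹' {p : ℝ × ℝ | 0 ≤ p.1 ∧ 0 ≤ p.2 ∧ p.1 + p.2 ≤ 1} = ∅ := by
        ext y
        simp only [Set.mem_preimage, Set.mem_ofPred_eq, Set.mem_empty_iff_false, iff_false]
        exact fun h => hx ⟨h.1, by linarith⟩
      rw [this, Set.indicator_of_notMem hx, measure_empty]
  rw [Measure.volume_eq_prod, Measure.prod_apply hm, lintegral_congr hslice,
    lintegral_indicator measurableSet_Icc, ← ofReal_integral_eq_lintegral_ofReal]
  · rw [integral_Icc_eq_integral_Ioc, ← intervalIntegral.integral_of_le zero_le_one,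
      intervalIntegral.integral_sub (by simp) (by simp), integral_id]
    norm_num
  · exact (by fun_prop : Continuous fun x : ℝ => 1 - x).integrableOn_Icc
  · exact (ae_restrict_iff' measurableSet_Icc).2 (.of_forall fun x hx => sub_nonneg.2 hx.2)

theorem volume_unitTriangle : volume unitTriangle = ENNReal.ofReal (1 / 2) := by
  rw [← volume_prod_triangle]
  have h := (volume_preserving_finTwoArrow ℝ).comp (PiLp.volume_preserving_ofLp (Fin 2))
  rw [← h.measure_preimage (MeasurableSet.nullMeasurableSet (by measurability))]
  rfl

theorem volume_unitSquare : volume unitSquare = 1 := by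
  have h : unitSquare = WithLp.ofLp ⁻¹' Set.univ.pi fun _ => Set.Ioo (0 : ℝ) 1 := by
    ext x
    simp [unitSquare]
  rw [h, (PiLp.volume_preserving_ofLp (Fin 2)).measure_preimage
    (MeasurableSet.univ_pi fun _ => measurableSet_Ioo).nullMeasurableSet, Real.volume_pi_Ioo]
  simp

theorem isOpen_unitSquare : IsOpen unitSquare := by
  simp only [unitSquare, Set.ofPred_forall]
  exact isOpen_iInter_of_finite fun i => isOpen_Ioo.preimage (by fun_prop)

theorem volume_triangle (u v : EuclideanSpace ℝ (Fin 2)) :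
    volume (frameMap u v '' unitTriangle) = ENNReal.ofReal (|cross u v| / 2) := by
  rw [volume_image_frameMap, volume_unitTriangle, ← ENNReal.ofReal_mul (abs_nonneg _), mul_one_div]

theorem volume_parallelogram (u v : EuclideanSpace ℝ (Fin 2)) :
    volume (frameMap u v '' unitSquare) = ENNReal.ofReal |cross u v| := by
  rw [volume_image_frameMap, volume_unitSquare, mul_one]

theorem cross_pos_of_mem_parallelogram {u v x : EuclideanSpace ℝ (Fin 2)} (h : 0 < cross u v)
    (hx : x ∈ frameMap u v '' unitSquare) : 0 < cross u x ∧ cross v x < 0 := by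
  obtain ⟨y, hy, rfl⟩ := hx
  have h0 := (hy 0).1
  have h1 := (hy 1).1
  have hu : cross u (frameMap u v y) = y 1 * cross u v := by
    simp [frameMap_apply, cross]; ring
  have hv : cross v (frameMap u v y) = -(y 0 * cross u v) := by
    simp [frameMap_apply, cross]; ring
  rw [hu, hv]
  exact ⟨by positivity, neg_lt_zero.2 (by positivity)⟩

theorem measurableSet_parallelogram {u v : EuclideanSpace ℝ (Fin 2)} (h : 0 < cross u v) :
    MeasurableSet (frameMap u v '' unitSquare) := by
  have hdet : LinearMap.det (frameMap u v) ≠ 0 := by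
    rw [frameMap, LinearMap.det_toLpLin, Matrix.det_fin_two_of, mul_comm (v 0)]
    exact h.ne'
  have := (LinearMap.equivOfDetNeZero (frameMap u v) hdet).toContinuousLinearEquiv.isOpenMap
    _ isOpen_unitSquare
  exact this.measurableSet

theorem parallelogram_subset {K : Set (EuclideanSpace ℝ (Fin 2))} (hK : Convex ℝ K)
    {u v : EuclideanSpace ℝ (Fin 2)} (h0 : (0 : EuclideanSpace ℝ (Fin 2)) ∈ K) (hu : u ∈ K)
    (hv : v ∈ K) (huv : u + v ∈ K) : frameMap u v '' unitSquare ⊆ K := by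
  rintro _ ⟨y, hy, rfl⟩
  obtain ⟨ha, ha'⟩ := hy 0
  obtain ⟨hb, hb'⟩ := hy 1
  have h1 : y 0 • u ∈ K := hK.smul_mem_of_zero_mem h0 hu ⟨ha.le, ha'.le⟩
  have h2 : (1 - y 0) • v + y 0 • (u + v) ∈ K := hK hv huv (by linarith) ha.le (by ring)
  have h3 := hK h1 h2 (sub_nonneg.2 hb'.le) hb.le (by ring)
  rw [frameMap_apply]
  convert h3 using 1
  module

/-- A point of the cone spanned by `u`, `v` on the same side as `0` of the line through `u` and
`v` lies in the triangle `0`, `u`, `v`. -/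
theorem mem_triangle {u v x : EuclideanSpace ℝ (Fin 2)} (h : 0 < cross u v)
    (hu : 0 ≤ cross u x) (hv : cross v x ≤ 0) (hx : cross u x - cross v x ≤ cross u v) :
    x ∈ frameMap u v '' unitTriangle := by
  refine ⟨planeVec (-cross v x / cross u v) (cross u x / cross u v), ⟨?_, ?_, ?_⟩, ?_⟩
  · simpa [planeVec] using div_nonneg (neg_nonneg.2 hv) h.le
  · simpa [planeVec] using div_nonneg hu h.le
  · simp only [planeVec, WithLp.equiv_symm_apply, Matrix.cons_val_zero, Matrix.cons_val_one]
    rw [← add_div, div_le_one h]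
    linarith
  · have hne := h.ne'
    ext i
    fin_cases i <;> simp [frameMap_apply, planeVec] <;> field_simp <;> simp only [cross] <;> ring

/-- The hexagon `conv{±v₁, ±v₂, ±v₃}` lies in every strip `|cross a ·| ≤ c` that contains
`v₁`, `v₂`, `v₃`. -/
theorem cross_le_of_mem_hull {v : Fin 3 → EuclideanSpace ℝ (Fin 2)} {a : EuclideanSpace ℝ (Fin 2)}
    {c : ℝ} (h : ∀ i, |cross a (v i)| ≤ c) {x : EuclideanSpace ℝ (Fin 2)}
    (hx : x ∈ convexHull ℝ (Set.range v ∪ Set.range fun i => -v i)) : |cross a x| ≤ c := by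
  have hlin : IsLinearMap ℝ (cross a) :=
    ⟨fun x y => by simp [cross]; ring, fun r x => by simp [cross]; ring⟩
  have hconv : Convex ℝ {x | |cross a x| ≤ c} := by
    simp only [abs_le, Set.ofPred_and]
    exact (convex_halfSpace_ge hlin _).inter (convex_halfSpace_le hlin _)
  refine convexHull_min ?_ hconv hx
  rintro _ (⟨i, rfl⟩ | ⟨i, rfl⟩)
  · exact h i
  · simpa only [Set.mem_ofPred_eq, hlin.map_neg, abs_neg] using h i

/-- If the signed areas satisfy the strict triangle inequalities, the hexagon is covered by the six
triangles joining `0` to its edges. -/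
theorem Fvol_le_of_cross {v : Fin 3 → EuclideanSpace ℝ (Fin 2)}
    (h₁ : cross (v 0) (v 1) < cross (v 1) (v 2) + cross (v 0) (v 2))
    (h₂ : cross (v 1) (v 2) < cross (v 0) (v 1) + cross (v 0) (v 2))
    (h₃ : cross (v 0) (v 2) < cross (v 0) (v 1) + cross (v 1) (v 2)) :
    Fvol v ≤
      ENNReal.ofReal (cross (v 0) (v 1) + cross (v 1) (v 2) + cross (v 0) (v 2)) := by
  have p₁ : 0 < cross (v 0) (v 1) := by linarith
  have p₂ : 0 < cross (v 1) (v 2) := by linarith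
  have p₃ : 0 < cross (v 0) (v 2) := by linarith
  have hself : ∀ a, cross a a = 0 := fun a => by simp [cross]; ring
  have hswap : ∀ a b, cross a b = -cross b a := fun a b => by simp [cross, mul_comm]
  have hsub : ∀ a b x, cross (a - b) x = cross a x - cross b x :=
    fun a b x => by simp [cross]; ring
  have hadd : ∀ a b x, cross (a + b) x = cross a x + cross b x :=
    fun a b x => by simp [cross]; ring
  have hneg : ∀ a x, cross (-a) x = -cross a x := fun a x => by simp [cross]; ring
  have hneg' : ∀ a x, cross a (-x) = -cross a x := fun a x => by simp [cross]; ring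
  have s10 := hswap (v 1) (v 0)
  have s21 := hswap (v 2) (v 1)
  have s20 := hswap (v 2) (v 0)
  have hcover : convexHull ℝ (Set.range v ∪ Set.range fun i => -v i) ⊆
      (frameMap (v 0) (v 1) '' unitTriangle ∪ frameMap (-v 0) (-v 1) '' unitTriangle) ∪
      (frameMap (v 1) (v 2) '' unitTriangle ∪ frameMap (-v 1) (-v 2) '' unitTriangle) ∪
      (frameMap (v 2) (-v 0) '' unitTriangle ∪ frameMap (-v 2) (v 0) '' unitTriangle) := by
    intro x hx
    have e₁ : |cross (v 0 - v 1) x| ≤ cross (v 0) (v 1) := by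
      refine cross_le_of_mem_hull (Fin.forall_fin_succ.2 ⟨?_, Fin.forall_fin_two.2 ⟨?_, ?_⟩⟩) hx <;>
        (try simp only [Fin.succ_zero_eq_one, Fin.succ_one_eq_two]) <;> rw [hsub, abs_le] <;>
        constructor <;> linarith [hself (v 0), hself (v 1)]
    have e₂ : |cross (v 1 - v 2) x| ≤ cross (v 1) (v 2) := by
      refine cross_le_of_mem_hull (Fin.forall_fin_succ.2 ⟨?_, Fin.forall_fin_two.2 ⟨?_, ?_⟩⟩) hx <;>
        (try simp only [Fin.succ_zero_eq_one, Fin.succ_one_eq_two]) <;> rw [hsub, abs_le] <;>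
        constructor <;> linarith [hself (v 1), hself (v 2)]
    have e₃ : |cross (v 2 + v 0) x| ≤ cross (v 0) (v 2) := by
      refine cross_le_of_mem_hull (Fin.forall_fin_succ.2 ⟨?_, Fin.forall_fin_two.2 ⟨?_, ?_⟩⟩) hx <;>
        (try simp only [Fin.succ_zero_eq_one, Fin.succ_one_eq_two]) <;> rw [hadd, abs_le] <;>
        constructor <;> linarith [hself (v 0), hself (v 2)]
    rw [hsub, abs_le] at e₁ e₂
    rw [hadd, abs_le] at e₃
    have n₁ : cross (-v 0) (-v 1) = cross (v 0) (v 1) := by rw [hneg, hneg', neg_neg]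
    have n₂ : cross (-v 1) (-v 2) = cross (v 1) (v 2) := by rw [hneg, hneg', neg_neg]
    have n₃ : cross (v 2) (-v 0) = cross (v 0) (v 2) := by rw [hneg', s20, neg_neg]
    have n₄ : cross (-v 2) (v 0) = cross (v 0) (v 2) := by rw [hneg, s20, neg_neg]
    have m₀ := hneg (v 0) x
    have m₁ := hneg (v 1) x
    have m₂ := hneg (v 2) x
    rcases le_total 0 (cross (v 0) x) with q₀ | q₀ <;>
      rcases le_total 0 (cross (v 1) x) with q₁ | q₁ <;>
      rcases le_total 0 (cross (v 2) x) with q₂ | q₂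
    · exact .inr (.inl (mem_triangle (by linarith) (by linarith) (by linarith) (by linarith)))
    · exact .inl (.inr (.inl (mem_triangle (by linarith) (by linarith) (by linarith) (by linarith))))
    · exact .inl (.inl (.inl (mem_triangle (by linarith) (by linarith) (by linarith) (by linarith))))
    · exact .inl (.inl (.inl (mem_triangle (by linarith) (by linarith) (by linarith) (by linarith))))
    · exact .inl (.inl (.inr (mem_triangle (by linarith) (by linarith) (by linarith) (by linarith))))
    · exact .inl (.inl (.inr (mem_triangle (by linarith) (by linarith) (by linarith) (by linarith))))
    · exact .inl (.inr (.inr (mem_triangle (by linarith) (by linarith) (by linarith) (by linarith))))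
    · exact .inr (.inr (mem_triangle (by linarith) (by linarith) (by linarith) (by linarith)))
  refine (measure_mono hcover).trans ?_
  have hpair : ∀ a b c d : EuclideanSpace ℝ (Fin 2), ∀ t, |cross a b| = t → |cross c d| = t →
      volume (frameMap a b '' unitTriangle ∪ frameMap c d '' unitTriangle) ≤ ENNReal.ofReal t := by
    rintro a b c d t h h'
    refine (measure_union_le _ _).trans ?_
    have ht : 0 ≤ t := h ▸ abs_nonneg _
    rw [volume_triangle, volume_triangle, h, h',
      ← ENNReal.ofReal_add (by positivity) (by positivity), add_halves]
  rw [ENNReal.ofReal_add (by positivity) p₃.le, ENNReal.ofReal_add p₁.le p₂.le]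
  refine (measure_union_le _ _).trans (add_le_add ((measure_union_le _ _).trans
    (add_le_add (hpair _ _ _ _ _ ?_ ?_) (hpair _ _ _ _ _ ?_ ?_))) (hpair _ _ _ _ _ ?_ ?_))
  · exact abs_of_pos p₁
  · rw [hneg, hneg', neg_neg, abs_of_pos p₁]
  · exact abs_of_pos p₂
  · rw [hneg, hneg', neg_neg, abs_of_pos p₂]
  · rw [hneg', s20, neg_neg, abs_of_pos p₃]
  · rw [hneg, s20, neg_neg, abs_of_pos p₃]

/-- When `v₂ = v₁ + v₃`, the hexagon contains three disjoint parallelograms meeting at `0`. -/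
theorem le_Fvol_of_eq_add {v : Fin 3 → EuclideanSpace ℝ (Fin 2)} (h : v 1 = v 0 + v 2)
    (hc : 0 < cross (v 0) (v 2)) : ENNReal.ofReal (3 * cross (v 0) (v 2)) ≤ Fvol v := by
  have hP : ∀ i, v i ∈ convexHull ℝ (Set.range v ∪ Set.range fun i => -v i) :=
    fun i => subset_convexHull _ _ (.inl ⟨i, rfl⟩)
  have hN : ∀ i, -v i ∈ convexHull ℝ (Set.range v ∪ Set.range fun i => -v i) :=
    fun i => subset_convexHull _ _ (.inr ⟨i, rfl⟩)
  have hK := convex_convexHull ℝ (Set.range v ∪ Set.range fun i => -v i)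
  have h0 : (0 : EuclideanSpace ℝ (Fin 2)) ∈
      convexHull ℝ (Set.range v ∪ Set.range fun i => -v i) := by
    convert hK (hP 0) (hN 0) (a := 1 / 2) (b := 1 / 2) (by norm_num) (by norm_num) (by norm_num)
      using 1
    module
  have c₁ : cross (v 2) (-v 1) = cross (v 0) (v 2) := by rw [h]; simp [cross]; ring
  have c₂ : cross (-v 1) (v 0) = cross (v 0) (v 2) := by rw [h]; simp [cross]; ring
  have hneg : ∀ a x, cross (-a) x = -cross a x := fun a x => by simp [cross]; ring
  have d₁ : Disjoint (frameMap (v 0) (v 2) '' unitSquare)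
      (frameMap (v 2) (-v 1) '' unitSquare) := by
    refine Set.disjoint_left.2 fun x hx hx' => ?_
    have := (cross_pos_of_mem_parallelogram hc hx).2
    have := (cross_pos_of_mem_parallelogram (c₁ ▸ hc) hx').1
    linarith
  have d₂ : Disjoint (frameMap (v 0) (v 2) '' unitSquare ∪ frameMap (v 2) (-v 1) '' unitSquare)
      (frameMap (-v 1) (v 0) '' unitSquare) := by
    refine Set.disjoint_left.2 fun x hx hx' => ?_
    have h₃ := cross_pos_of_mem_parallelogram (c₂ ▸ hc) hx'
    rcases hx with hx | hx
    · have := (cross_pos_of_mem_parallelogram hc hx).1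
      linarith
    · have := (cross_pos_of_mem_parallelogram (c₁ ▸ hc) hx).2
      linarith
  have hsub : frameMap (v 0) (v 2) '' unitSquare ∪ frameMap (v 2) (-v 1) '' unitSquare ∪
      frameMap (-v 1) (v 0) '' unitSquare ⊆
      convexHull ℝ (Set.range v ∪ Set.range fun i => -v i) := by
    refine Set.union_subset (Set.union_subset ?_ ?_) ?_
    · exact parallelogram_subset hK h0 (hP 0) (hP 2) (h ▸ hP 1)
    · refine parallelogram_subset hK h0 (hP 2) (hN 1) ?_
      have : v 2 + -v 1 = -v 0 := by rw [h]; abel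
      exact this ▸ hN 0
    · refine parallelogram_subset hK h0 (hN 1) (hP 0) ?_
      have : -v 1 + v 0 = -v 2 := by rw [h]; abel
      exact this ▸ hN 2
  refine le_trans (le_of_eq ?_) (measure_mono hsub)
  rw [measure_union d₂ (measurableSet_parallelogram (c₂ ▸ hc)),
    measure_union d₁ (measurableSet_parallelogram (c₁ ▸ hc)), volume_parallelogram,
    volume_parallelogram, volume_parallelogram, c₁, c₂, abs_of_pos hc,
    ← ENNReal.ofReal_add hc.le hc.le, ← ENNReal.ofReal_add (by positivity) hc.le]
  congr 1
  ring

theorem IsUframe.gram {v : Fin 3 → EuclideanSpace ℝ (Fin 2)} (h : IsUframe v) :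
    v 0 0 ^ 2 + v 1 0 ^ 2 + v 2 0 ^ 2 = 1 ∧ v 0 1 ^ 2 + v 1 1 ^ 2 + v 2 1 ^ 2 = 1 ∧
      v 0 0 * v 0 1 + v 1 0 * v 1 1 + v 2 0 * v 2 1 = 0 := by
  have h₁ := h (EuclideanSpace.single 0 1)
  have h₂ := h (EuclideanSpace.single 1 1)
  have e₁ := congrArg (fun x => x 0) h₁
  have e₂ := congrArg (fun x => x 1) h₂
  have e₃ := congrArg (fun x => x 1) h₁
  simp [Fin.sum_univ_three, PiLp.inner_apply] at e₁ e₂ e₃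
  exact ⟨by linarith, by linarith, by linarith⟩

/-- Cauchy–Binet for a `(3,2)`-uframe. -/
theorem IsUframe.sum_cross_sq {v : Fin 3 → EuclideanSpace ℝ (Fin 2)} (h : IsUframe v) :
    cross (v 0) (v 1) ^ 2 + cross (v 1) (v 2) ^ 2 + cross (v 0) (v 2) ^ 2 = 1 := by
  obtain ⟨h₁, h₂, h₃⟩ := h.gram
  have key : cross (v 0) (v 1) ^ 2 + cross (v 1) (v 2) ^ 2 + cross (v 0) (v 2) ^ 2 =
      (v 0 0 ^ 2 + v 1 0 ^ 2 + v 2 0 ^ 2) * (v 0 1 ^ 2 + v 1 1 ^ 2 + v 2 1 ^ 2) -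
      (v 0 0 * v 0 1 + v 1 0 * v 1 1 + v 2 0 * v 2 1) ^ 2 := by
    simp only [cross]; ring
  rw [key, h₁, h₂, h₃]
  norm_num

theorem IsUframe.sum_cross_le {v : Fin 3 → EuclideanSpace ℝ (Fin 2)} (h : IsUframe v) :
    cross (v 0) (v 1) + cross (v 1) (v 2) + cross (v 0) (v 2) ≤ √3 := by
  refine Real.le_sqrt_of_sq_le ?_
  nlinarith [h.sum_cross_sq, sq_nonneg (cross (v 0) (v 1) - cross (v 1) (v 2)),
    sq_nonneg (cross (v 0) (v 1) - cross (v 0) (v 2)),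
    sq_nonneg (cross (v 1) (v 2) - cross (v 0) (v 2))]

theorem cos_sin_two_pi_div_three : cos (2 * π / 3) = -(1 / 2) ∧ sin (2 * π / 3) = √3 / 2 := by
  have h : 2 * π / 3 = π - π / 3 := by ring
  rw [h, cos_pi_sub, sin_pi_sub, cos_pi_div_three, sin_pi_div_three]
  exact ⟨rfl, rfl⟩

theorem planeVec_neg (a b : ℝ) : planeVec (-a) (-b) = -planeVec a b := by
  ext i
  fin_cases i <;> simp [planeVec]

/-- Adding opposite points to three consecutive vertices completes the regular hexagon. -/
theorem isRegularHexagon_hull {r : ℝ} (hr : 0 < r) {w : Fin 3 → EuclideanSpace ℝ (Fin 2)}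
    (hw : ∀ j : Fin 3, w j = r • planeVec (cos (j * π / 3)) (sin (j * π / 3))) :
    IsRegularHexagon (convexHull ℝ (Set.range w ∪ Set.range fun i => -w i)) := by
  refine ⟨0, r, 0, hr, congrArg _ ?_⟩
  have hP : ∀ j : Fin 3, w j = 0 + r • planeVec (cos (0 + (j.castAdd 3 : Fin 6) * π / 3))
      (sin (0 + (j.castAdd 3 : Fin 6) * π / 3)) := by
    intro j
    rw [zero_add, zero_add, hw, Fin.val_castAdd]
  have hN : ∀ j : Fin 3, -w j = 0 + r • planeVec (cos (0 + (j.addNat 3 : Fin 6) * π / 3))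
      (sin (0 + (j.addNat 3 : Fin 6) * π / 3)) := by
    intro j
    have : (((j.addNat 3 : Fin 6) : ℕ) : ℝ) * π / 3 = (j : ℕ) * π / 3 + π := by
      rw [Fin.val_addNat]
      push_cast
      ring
    rw [zero_add, zero_add, this, cos_add_pi, sin_add_pi, planeVec_neg, smul_neg, hw]
  ext x
  constructor
  · rintro (⟨j, rfl⟩ | ⟨j, rfl⟩)
    · exact ⟨j.castAdd 3, (hP j).symm⟩
    · exact ⟨j.addNat 3, (hN j).symm⟩
  · rintro ⟨j, rfl⟩
    induction j using Fin.addCases (m := 3) (n := 3) with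
    | left i => exact .inl ⟨i, hP i⟩
    | right i =>
      have : Fin.natAdd 3 i = i.addNat 3 := by ext; simp
      exact .inr ⟨i, by rw [this]; exact hN i⟩

/-- Let `W = {w₁, w₂, w₃} ⊂ ℝ²` with `wⱼ₊₁ = √(2/3)·(cos(jπ/3), sin(jπ/3))`, `j = 0,1,2`.
Then `W` is a `(3,2)`-uframe, `conv{±w₁, ±w₂, ±w₃}` is a regular hexagon, and `W` is a
local maximum of `F` on the set of `(3,2)`-uframes. -/
theorem hexagon_uframe_local_max (w : Fin 3 → EuclideanSpace ℝ (Fin 2))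
    (hw : ∀ j : Fin 3,
      w j = Real.sqrt (2 / 3) • planeVec (Real.cos (j * π / 3)) (Real.sin (j * π / 3))) :
    IsUframe w ∧
    IsRegularHexagon (convexHull ℝ (Set.range w ∪ Set.range fun i => -w i)) ∧
    ∃ ε > (0 : ℝ), ∀ v : Fin 3 → EuclideanSpace ℝ (Fin 2), IsUframe v →
      (∀ i, ‖v i - w i‖ < ε) → Fvol v ≤ Fvol w := by
  have c₀ : ∀ a b : ℝ, planeVec a b 0 = a := fun a b => by simp [planeVec]
  have c₁ : ∀ a b : ℝ, planeVec a b 1 = b := fun a b => by simp [planeVec]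
  set r := √(2 / 3)
  have hr2 : r ^ 2 = 2 / 3 := Real.sq_sqrt (by norm_num)
  have hrpos : 0 < r := Real.sqrt_pos.2 (by norm_num)
  have h3 : √3 ^ 2 = 3 := Real.sq_sqrt (by norm_num)
  have w0 : w 0 = planeVec r 0 := by
    rw [hw]
    ext i
    fin_cases i <;> simp [planeVec]
  have w1 : w 1 = planeVec (r / 2) (r * √3 / 2) := by
    rw [hw]
    ext i
    fin_cases i <;> simp [planeVec, cos_pi_div_three, sin_pi_div_three] <;> ring
  have w2 : w 2 = planeVec (-(r / 2)) (r * √3 / 2) := by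
    rw [hw]
    ext i
    fin_cases i <;> simp [planeVec, cos_sin_two_pi_div_three] <;> ring
  have hadd : w 1 = w 0 + w 2 := by
    rw [w0, w1, w2]
    ext i
    fin_cases i <;> simp [planeVec]
    ring
  have x₁ : cross (w 0) (w 1) = √3 / 3 := by
    rw [w0, w1]
    simp only [cross, c₀, c₁]
    linear_combination √3 / 2 * hr2
  have x₂ : cross (w 1) (w 2) = √3 / 3 := by
    rw [w1, w2]
    simp only [cross, c₀, c₁]
    linear_combination √3 / 2 * hr2
  have x₃ : cross (w 0) (w 2) = √3 / 3 := by
    rw [w0, w2]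
    simp only [cross, c₀, c₁]
    linear_combination √3 / 2 * hr2
  have hpos : 0 < √3 / 3 := by positivity
  refine ⟨fun x => ?_, isRegularHexagon_hull hrpos hw, ?_⟩
  · rw [Fin.sum_univ_three, w0, w1, w2]
    ext i
    fin_cases i
    · simp [planeVec, PiLp.inner_apply]
      linear_combination 3 / 2 * x 0 * hr2
    · simp [planeVec, PiLp.inner_apply]
      linear_combination (r ^ 2 / 2 * x 1) * h3 + 3 / 2 * x 1 * hr2
  · have hcont : ∀ i j : Fin 3, Continuous fun v : Fin 3 → EuclideanSpace ℝ (Fin 2) =>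
        cross (v i) (v j) := fun i j => by unfold cross; fun_prop
    have hev : ∀ᶠ v in nhds w,
        cross (v 0) (v 1) < cross (v 1) (v 2) + cross (v 0) (v 2) ∧
        cross (v 1) (v 2) < cross (v 0) (v 1) + cross (v 0) (v 2) ∧
        cross (v 0) (v 2) < cross (v 0) (v 1) + cross (v 1) (v 2) := by
      refine ((hcont 0 1).continuousAt.eventually_lt
        ((hcont 1 2).add (hcont 0 2)).continuousAt ?_).and
        (((hcont 1 2).continuousAt.eventually_lt
        ((hcont 0 1).add (hcont 0 2)).continuousAt ?_).and
        ((hcont 0 2).continuousAt.eventually_lt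
        ((hcont 0 1).add (hcont 1 2)).continuousAt ?_)) <;>
        simp only [Pi.add_apply, x₁, x₂, x₃] <;> linarith
    obtain ⟨ε, hε, H⟩ := Metric.eventually_nhds_iff.1 hev
    refine ⟨ε, hε, fun v hv hvw => ?_⟩
    obtain ⟨h₁, h₂, h₃⟩ := H ((dist_pi_lt_iff hε).2 fun i => by
      rw [dist_eq_norm]; exact hvw i)
    calc Fvol v ≤ _ := Fvol_le_of_cross h₁ h₂ h₃
      _ ≤ ENNReal.ofReal (3 * cross (w 0) (w 2)) :=
        ENNReal.ofReal_le_ofReal (by rw [x₃]; linarith [hv.sum_cross_le])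
      _ ≤ Fvol w := le_Fvol_of_eq_add hadd (x₃ ▸ hpos)
end

section
/- For every pair of integers n > k ≥ 2 there exists an (n,k)-uframe S which is a local maximum of F on the set of (n,k)-uframes (i.e., there is ε > 0 such that F(S') ≤ F(S) for every (n,k)-uframe S' = {v'₁,…,v'ₙ} with |v'ᵢ − vᵢ| < ε for all i) but is not a global maximum: F(S) < sup{F(S') : S' an (n,k)-uframe}. -/
open MeasureTheory
open scoped RealInnerProductSpace ENNReal

/-- The matrix whose columns are the vectors `v b`. -/
def colMatrix {k l : ℕ} (v : Fin l → EuclideanSpace ℝ (Fin k)) : Matrix (Fin k) (Fin l) ℝ :=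
  Matrix.of fun a b => v b a

/-- The linear map sending the `b`-th standard basis vector to `v b`. -/
noncomputable def combMap {k : ℕ} (v : Fin k → EuclideanSpace ℝ (Fin k)) :
    EuclideanSpace ℝ (Fin k) →ₗ[ℝ] EuclideanSpace ℝ (Fin k) :=
  Fintype.linearCombination ℝ v ∘ₗ (WithLp.linearEquiv 2 ℝ (Fin k → ℝ)).toLinearMap

theorem combMap_apply {k : ℕ} (v : Fin k → EuclideanSpace ℝ (Fin k))
    (x : EuclideanSpace ℝ (Fin k)) : combMap v x = ∑ b, x b • v b := by
  simp [combMap, Fintype.linearCombination_apply]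

theorem det_combMap {k : ℕ} (v : Fin k → EuclideanSpace ℝ (Fin k)) :
    LinearMap.det (combMap v) = (colMatrix v).det := by
  rw [← LinearMap.det_toMatrix (EuclideanSpace.basisFun (Fin k) ℝ).toBasis]
  congr 1
  ext a b
  simp [LinearMap.toMatrix_apply, combMap_apply, colMatrix]

/-- The unit ball of the `ℓ¹` norm. -/
def crossPolytope (k : ℕ) : Set (EuclideanSpace ℝ (Fin k)) := {x | ∑ b, |x b| ≤ 1}

/-- The part of the `ℓ¹` ball where the first two coordinates have opposite signs. -/
def halfCross (m : ℕ) : Set (EuclideanSpace ℝ (Fin (m + 2))) :=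
  {x | x 0 * x 1 ≤ 0 ∧ ∑ b, |x b| ≤ 1}

theorem isCompact_crossPolytope (k : ℕ) : IsCompact (crossPolytope k) := by
  apply Metric.isCompact_of_isClosed_isBounded
  · exact isClosed_le (by fun_prop) continuous_const
  · refine (Metric.isBounded_closedBall (x := (0 : EuclideanSpace ℝ (Fin k)))
      (r := ∑ _b : Fin k, 1)).subset fun x hx => ?_
    rw [mem_closedBall_zero_iff]
    calc ‖x‖ = ‖∑ b, x b • EuclideanSpace.basisFun (Fin k) ℝ b‖ := by
            congr 1; exact ((EuclideanSpace.basisFun (Fin k) ℝ).sum_repr x).symm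
      _ ≤ ∑ b, ‖x b • EuclideanSpace.basisFun (Fin k) ℝ b‖ := norm_sum_le _ _
      _ ≤ ∑ _b : Fin k, 1 := by
        refine Finset.sum_le_sum fun b _ => ?_
        rw [norm_smul, (EuclideanSpace.basisFun (Fin k) ℝ).norm_eq_one, mul_one, Real.norm_eq_abs]
        exact (Finset.single_le_sum (f := fun b => |x b|) (fun _ _ => abs_nonneg _)
          (Finset.mem_univ b)).trans hx

theorem isCompact_halfCross (m : ℕ) : IsCompact (halfCross m) := by
  have : halfCross m = crossPolytope (m + 2) ∩ {x | x 0 * x 1 ≤ 0} := by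
    ext x; simp [halfCross, crossPolytope, and_comm]
  rw [this]
  exact (isCompact_crossPolytope _).inter_right (isClosed_le (by fun_prop) continuous_const)

theorem volume_inner_eq_zero {k : ℕ} {w : EuclideanSpace ℝ (Fin k)} (hw : w ≠ 0) :
    volume {x : EuclideanSpace ℝ (Fin k) | ⟪w, x⟫ = 0} = 0 := by
  have h := Measure.addHaar_submodule (volume : Measure (EuclideanSpace ℝ (Fin k)))
    (innerSL ℝ w).ker ?_
  · convert h using 2
    ext x
    simp
  · intro h
    have : w ∈ (innerSL ℝ w).ker := h ▸ Submodule.mem_top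
    exact hw (by simpa using this)

theorem volume_combMap_image {k : ℕ} (v : Fin k → EuclideanSpace ℝ (Fin k))
    (s : Set (EuclideanSpace ℝ (Fin k))) :
    volume (combMap v '' s) = ENNReal.ofReal |(colMatrix v).det| * volume s := by
  rw [Measure.addHaar_image_linearMap, det_combMap]

theorem volume_halfCross_ne_top (m : ℕ) : volume (halfCross m) ≠ ∞ :=
  (isCompact_halfCross m).measure_lt_top.ne

/-- The standard basis with the first vector negated. -/
noncomputable def flipBasis (m : ℕ) (b : Fin (m + 2)) : EuclideanSpace ℝ (Fin (m + 2)) :=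
  EuclideanSpace.single b (if b = 0 then -1 else 1)

theorem combMap_flipBasis_apply {m : ℕ} (x : EuclideanSpace ℝ (Fin (m + 2))) (a : Fin (m + 2)) :
    combMap (flipBasis m) x a = if a = 0 then -x a else x a := by
  rw [combMap_apply]
  simp [flipBasis, Pi.single_apply]

theorem abs_det_flipBasis (m : ℕ) : |(colMatrix (flipBasis m)).det| = 1 := by
  have : colMatrix (flipBasis m) =
      Matrix.diagonal fun b : Fin (m + 2) => if b = 0 then (-1 : ℝ) else 1 := by
    ext a b
    by_cases h : a = b
    · subst h; simp [colMatrix, flipBasis]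
    · simp [colMatrix, flipBasis, h]
  rw [this, Matrix.det_diagonal, Finset.abs_prod]
  exact Finset.prod_eq_one fun b _ => by split_ifs <;> simp

theorem crossPolytope_eq_union (m : ℕ) :
    crossPolytope (m + 2) = combMap (flipBasis m) '' halfCross m ∪ halfCross m := by
  have key : ∀ x ∈ crossPolytope (m + 2), combMap (flipBasis m) x ∈ crossPolytope (m + 2) := by
    intro x hx
    have hx' : ∑ b, |x b| ≤ 1 := hx
    refine le_trans (le_of_eq (Finset.sum_congr rfl fun b _ => ?_)) hx'
    rw [combMap_flipBasis_apply]
    split_ifs <;> simp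
  apply Set.Subset.antisymm
  · intro x hx
    rcases le_total (x 0 * x 1) 0 with h | h
    · exact Or.inr ⟨h, hx⟩
    · refine Or.inl ⟨combMap (flipBasis m) x, ⟨?_, key x hx⟩, ?_⟩
      · simpa [combMap_flipBasis_apply] using h
      · ext a
        simp only [combMap_flipBasis_apply]
        split_ifs <;> simp
  · rintro _ (⟨x, hx, rfl⟩ | hx)
    · exact key x hx.2
    · exact hx.2

theorem volume_crossPolytope (m : ℕ) :
    volume (crossPolytope (m + 2)) = 2 * volume (halfCross m) := by
  have hne : ∀ a : Fin (m + 2),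
      volume {x : EuclideanSpace ℝ (Fin (m + 2)) | x a = 0} = 0 := fun a => by
    have h : (EuclideanSpace.single a (1 : ℝ)) ≠ 0 := by simp
    simpa [EuclideanSpace.inner_single_left] using volume_inner_eq_zero h
  rw [crossPolytope_eq_union, measure_union₀ (isCompact_halfCross m).measurableSet.nullMeasurableSet,
    volume_combMap_image, abs_det_flipBasis, ENNReal.ofReal_one, one_mul, two_mul]
  refine measure_mono_null ?_ (measure_union_null (hne 0) (hne 1))
  rintro _ ⟨⟨x, hx, rfl⟩, hy⟩
  have h1 := hx.1
  have h2 := hy.1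
  simp only [combMap_flipBasis_apply] at h2
  have h3 : x 0 * x 1 = 0 := le_antisymm h1 (by simpa using h2)
  rcases mul_eq_zero.1 h3 with h | h
  · left; simp [combMap_flipBasis_apply, h]
  · right; simp [combMap_flipBasis_apply, h]

theorem volume_halfCross_ne_zero (m : ℕ) : volume (halfCross m) ≠ 0 := by
  intro h
  have h0 : volume (crossPolytope (m + 2)) = 0 := by rw [volume_crossPolytope, h, mul_zero]
  refine (Measure.measure_pos_of_mem_nhds volume (x := 0) ?_).ne' h0
  have hc : Continuous fun x : EuclideanSpace ℝ (Fin (m + 2)) => ∑ b, |x b| := by fun_prop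
  exact Filter.mem_of_superset ((hc.tendsto 0).eventually_lt_const (u := 1) (by simp))
    fun x (hx : ∑ b, |x b| < 1) => hx.le

theorem sum_smul_mem_convexHull {k n p : ℕ} {v : Fin n → EuclideanSpace ℝ (Fin k)}
    {w : Fin p → EuclideanSpace ℝ (Fin k)} (hw : ∀ i, w i ∈ Set.range v)
    {c : Fin p → ℝ} (hc : ∑ i, |c i| ≤ 1) (hn : 0 < n) :
    ∑ i, c i • w i ∈ convexHull ℝ (Set.range v ∪ Set.range fun i => -v i) := by
  set H := convexHull ℝ (Set.range v ∪ Set.range fun i => -v i)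
  have hconv : Convex ℝ H := convex_convexHull _ _
  have hpos : ∀ i, v i ∈ H := fun i => subset_convexHull _ _ (Or.inl ⟨i, rfl⟩)
  have hneg : ∀ i, -v i ∈ H := fun i => subset_convexHull _ _ (Or.inr ⟨i, rfl⟩)
  have hzero : (0 : EuclideanSpace ℝ (Fin k)) ∈ H := by
    have := hconv (hpos ⟨0, hn⟩) (hneg ⟨0, hn⟩) (a := 1 / 2) (b := 1 / 2)
      (by norm_num) (by norm_num) (by norm_num)
    simpa using this
  have hsign : ∀ i, (SignType.sign (c i) : ℝ) • w i ∈ H := by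
    intro i
    obtain ⟨j, hj⟩ := hw i
    rw [← hj]
    rcases lt_trichotomy (c i) 0 with h | h | h <;> simp [h, hpos, hneg, hzero]
  have := hconv.sum_mem (t := Finset.univ)
    (w := fun o : Option (Fin p) => o.elim (1 - ∑ i, |c i|) fun i => |c i|)
    (z := fun o : Option (Fin p) => o.elim 0 fun i => (SignType.sign (c i) : ℝ) • w i)
    ?_ ?_ ?_
  · simpa [Fintype.sum_option, smul_smul, abs_mul_sign] using this
  · rintro (_ | i) -
    · simpa using hc
    · simp
  · simp [Fintype.sum_option]
  · rintro (_ | i) -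
    · exact hzero
    · exact hsign i

theorem abs_det_le_prod_norm {N : ℕ} (r : Fin N → EuclideanSpace ℝ (Fin N)) :
    |(colMatrix r).det| ≤ ∏ i, ‖r i‖ := by
  have : Fact (Module.finrank ℝ (EuclideanSpace ℝ (Fin N)) = N) := ⟨by simp⟩
  have h := (EuclideanSpace.basisFun (Fin N) ℝ).toBasis.orientation.abs_volumeForm_apply_le r
  rwa [Orientation.volumeForm_robust _ (EuclideanSpace.basisFun (Fin N) ℝ) rfl,
    Module.Basis.det_apply] at h

theorem isUframe_iff {n k : ℕ} {v : Fin n → EuclideanSpace ℝ (Fin k)} :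
    IsUframe v ↔ ∀ a b, ∑ i, v i a * v i b = if a = b then 1 else 0 := by
  constructor
  · intro h a b
    have := congrArg (fun y : EuclideanSpace ℝ (Fin k) => y a)
      (h (EuclideanSpace.single b (1 : ℝ)))
    simpa [EuclideanSpace.inner_single_right, Pi.single_apply, mul_comm] using this
  · intro h x
    ext a
    calc (∑ i, ⟪v i, x⟫ • v i) a = ∑ i, ∑ b, x b * (v i a * v i b) := by
          simp only [PiLp.inner_apply, WithLp.ofLp_sum, Finset.sum_apply, PiLp.smul_apply,
            smul_eq_mul, Finset.sum_mul]
          refine Finset.sum_congr rfl fun i _ => Finset.sum_congr rfl fun b _ => ?_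
          simp; ring
      _ = x a := by
          rw [Finset.sum_comm]
          simp_rw [← Finset.mul_sum, h]
          simp

/-- The first three indices. -/
def headIdx (m : ℕ) (j : Fin 3) : Fin (m + 3) := Fin.castLE (by omega) j

/-- The indicator function of the first three indices. -/
noncomputable def headInd (m : ℕ) (i : Fin (m + 3)) : ℝ := if i.val < 3 then 1 else 0

theorem headInd_headIdx (m : ℕ) (j : Fin 3) : headInd m (headIdx m j) = 1 := by
  simp [headInd, headIdx]

theorem sum_headInd_smul {m : ℕ} {M : Type*} [AddCommGroup M] [Module ℝ M] (f : Fin (m + 3) → M) :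
    ∑ i, headInd m i • f i = ∑ j, f (headIdx m j) := by
  have h0 : headInd m 0 = 1 := if_pos (by change 0 < 3; norm_num)
  have h1 : headInd m (Fin.succ 0) = 1 := if_pos (by change 0 + 1 < 3; norm_num)
  have h2 : headInd m (Fin.succ (Fin.succ 0)) = 1 := if_pos (by change 0 + 1 + 1 < 3; norm_num)
  have h3 : ∀ i : Fin m, headInd m i.succ.succ.succ = 0 := fun i => if_neg (by simp)
  rw [Fin.sum_univ_succ, Fin.sum_univ_succ, Fin.sum_univ_succ, Fin.sum_univ_three]
  simp only [h0, h1, h2, h3, one_smul, zero_smul, Finset.sum_const_zero, add_zero]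
  rw [← add_assoc]
  rfl

/-- The absolute value of the determinant of the family with the `j`-th vector omitted. -/
noncomputable def minorAbs {m : ℕ} (v : Fin (m + 3) → EuclideanSpace ℝ (Fin (m + 2)))
    (j : Fin (m + 3)) : ℝ :=
  |(colMatrix fun b => v (j.succAbove b)).det|

theorem det_eq_sum_minors {m : ℕ} (v : Fin (m + 3) → EuclideanSpace ℝ (Fin (m + 2)))
    (A : Matrix (Fin (m + 3)) (Fin (m + 3)) ℝ) (hA : ∀ i a, A i (Fin.succ a) = v i a) :
    A.det = ∑ i : Fin (m + 3), (-1) ^ (i : ℕ) * A i 0 *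
      (colMatrix fun b => v (i.succAbove b)).det := by
  rw [Matrix.det_succ_column_zero]
  refine Finset.sum_congr rfl fun i _ => ?_
  rw [← Matrix.det_transpose (colMatrix _)]
  congr 2
  ext a b
  simp [colMatrix, hA]

theorem sum_minorAbs_le {m : ℕ} (v : Fin (m + 3) → EuclideanSpace ℝ (Fin (m + 2)))
    (hv : ∀ a, ∑ i, v i a ^ 2 ≤ 1) : ∑ j, minorAbs v (headIdx m j) ≤ √3 := by
  set d : Fin (m + 3) → ℝ := fun i => (colMatrix fun b => v (i.succAbove b)).det with hd
  set s : Fin (m + 3) → ℝ := fun i => (-1) ^ (i : ℕ) * (headInd m i * SignType.sign (d i)) with hs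
  set r : Fin (m + 3) → EuclideanSpace ℝ (Fin (m + 3)) :=
    Fin.cons (WithLp.toLp 2 s) fun a => WithLp.toLp 2 fun i => v i a with hr
  have hdet := det_eq_sum_minors v (colMatrix r) (fun i a => by simp [colMatrix, hr])
  have h1 : (colMatrix r).det = ∑ j, minorAbs v (headIdx m j) := by
    rw [hdet, ← sum_headInd_smul]
    refine Finset.sum_congr rfl fun i _ => ?_
    have h2 : ((-1 : ℝ) ^ (i : ℕ)) * (-1) ^ (i : ℕ) = 1 := by
      rw [← mul_pow]; simp
    have h3 : minorAbs v i = SignType.sign (d i) * d i := by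
      rw [sign_mul_self]; rfl
    rw [h3, smul_eq_mul]
    simp only [colMatrix, Matrix.of_apply, hr, Fin.cons_zero, hs]
    change _ * _ * d i = _
    linear_combination (headInd m i * SignType.sign (d i) * d i) * h2
  have h4 : ∀ a : Fin (m + 2), ‖r a.succ‖ ≤ 1 := fun a => by
    rw [EuclideanSpace.norm_eq]
    exact Real.sqrt_le_one.2 (by simpa [hr] using hv a)
  have h5 : ‖r 0‖ ≤ √3 := by
    rw [EuclideanSpace.norm_eq]
    apply Real.sqrt_le_sqrt
    calc ∑ i, ‖r 0 i‖ ^ 2 ≤ ∑ i, headInd m i • (1 : ℝ) := by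
          refine Finset.sum_le_sum fun i _ => ?_
          have : |(SignType.sign (d i) : ℝ)| ≤ 1 := by
            rcases lt_trichotomy (d i) 0 with h | h | h <;> simp [h]
          simp only [hr, Fin.cons_zero, hs, headInd]
          split_ifs
          · simpa [abs_mul] using this
          · simp
      _ = 3 := by rw [sum_headInd_smul]; simp
  calc _ ≤ |(colMatrix r).det| := by rw [← h1]; exact le_abs_self _
    _ ≤ ∏ i, ‖r i‖ := abs_det_le_prod_norm r
    _ = ‖r 0‖ * ∏ a : Fin (m + 2), ‖r a.succ‖ := Fin.prod_univ_succ _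
    _ ≤ √3 * 1 := mul_le_mul h5 (Finset.prod_le_one (fun _ _ => norm_nonneg _) fun a _ => h4 a)
        (Finset.prod_nonneg fun _ _ => norm_nonneg _) (Real.sqrt_nonneg _)
    _ = √3 := mul_one _

theorem exists_hexagonal_frame (m : ℕ) :
    ∃ w : Fin (m + 3) → EuclideanSpace ℝ (Fin (m + 2)), IsUframe w ∧
      (∀ i j, ⟪w i, w j⟫ = (if i = j then 1 else 0) - headInd m i * headInd m j / 3) ∧
      ∑ i, headInd m i • w i = 0 ∧ √3 ≤ ∑ j, minorAbs w (headIdx m j) := by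
  set u : EuclideanSpace ℝ (Fin (m + 3)) := WithLp.toLp 2 fun i => headInd m i / √3 with hu
  have h3 : √3 * √3 = (3 : ℝ) := Real.mul_self_sqrt (by norm_num)
  have h30 : √3 ≠ (0 : ℝ) := by positivity
  have hsq : ∀ i, headInd m i * headInd m i = headInd m i := fun i => by
    simp only [headInd]; split_ifs <;> simp
  have hnorm : ‖u‖ = 1 := by
    rw [EuclideanSpace.norm_eq, Real.sqrt_eq_one]
    have : ∑ i, headInd m i • (1 : ℝ) = 3 := by rw [sum_headInd_smul]; simp
    simp only [smul_eq_mul, mul_one] at this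
    calc ∑ i, ‖u i‖ ^ 2 = ∑ i, headInd m i / 3 := by
          refine Finset.sum_congr rfl fun i _ => ?_
          simp only [hu, Real.norm_eq_abs, sq_abs]
          rw [div_pow, sq, hsq, sq, h3]
      _ = 1 := by rw [← Finset.sum_div, this]; norm_num
  obtain ⟨b, hb⟩ := Orthonormal.exists_orthonormalBasis_extension_of_card_eq
    (𝕜 := ℝ) (E := EuclideanSpace ℝ (Fin (m + 3))) (ι := Fin (m + 3)) (by simp)
    (v := fun _ => u) (s := {0})
    (by rw [orthonormal_subsingleton_iff]; intro i; simpa using hnorm)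
  have hb0 : b 0 = u := hb 0 rfl
  set A := colMatrix b with hA
  have hcol : A.transpose * A = 1 := by
    ext i j
    have := orthonormal_iff_ite.1 b.orthonormal i j
    simpa [Matrix.mul_apply, hA, colMatrix, Matrix.one_apply, PiLp.inner_apply, mul_comm]
      using this
  have hrow : A * A.transpose = 1 := mul_eq_one_comm.1 hcol
  set w : Fin (m + 3) → EuclideanSpace ℝ (Fin (m + 2)) :=
    fun i => WithLp.toLp 2 fun a => b a.succ i with hw
  have hA0 : ∀ i, A i 0 = headInd m i / √3 := fun i => by simp [hA, colMatrix, hb0, hu]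
  have hcol' : ∀ c d, ∑ i, A i c * A i d = if c = d then 1 else 0 := fun c d => by
    simpa [Matrix.mul_apply, Matrix.one_apply] using congrFun (congrFun hcol c) d
  refine ⟨w, isUframe_iff.2 fun c d => ?_, fun i j => ?_, ?_, ?_⟩
  · simpa [hw, hA, colMatrix] using hcol' c.succ d.succ
  · have := congrFun (congrFun hrow i) j
    rw [Matrix.mul_apply, Fin.sum_univ_succ, Matrix.one_apply] at this
    simp only [Matrix.transpose_apply, hA0] at this
    rw [← this, div_mul_div_comm, h3, add_sub_cancel_left]
    simp [hw, hA, colMatrix, PiLp.inner_apply, mul_comm]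
  · ext a
    have := hcol' 0 a.succ
    simp only [hA0, div_mul_eq_mul_div, ← Finset.sum_div] at this
    rw [if_neg (Fin.succ_ne_zero a).symm, div_eq_zero_iff] at this
    simpa [hw, hA, colMatrix] using this.resolve_right h30
  · have hdet : A.det * A.det = 1 := by
      simpa using congrArg Matrix.det hcol
    have habs : |A.det| = 1 := by
      rcases mul_self_eq_one_iff.1 hdet with h | h <;> simp [h]
    have hexp := det_eq_sum_minors w A (fun i a => by simp [hw, hA, colMatrix])
    have : (1 : ℝ) ≤ (∑ j, minorAbs w (headIdx m j)) / √3 := by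
      rw [← habs, hexp, ← sum_headInd_smul, Finset.sum_div]
      refine (Finset.abs_sum_le_sum_abs _ _).trans (Finset.sum_le_sum fun i _ => ?_)
      have : 0 ≤ headInd m i := by simp only [headInd]; split_ifs <;> simp
      simp [abs_mul, hA0, minorAbs, abs_div, abs_of_nonneg this, abs_of_nonneg (Real.sqrt_nonneg 3),
        div_mul_eq_mul_div]
    rwa [le_div_iff₀ (by positivity), one_mul] at this

theorem headIdx_succAbove_zero (m : ℕ) (j : Fin 3) :
    (headIdx m j).succAbove 0 = headIdx m (j.succAbove 0) := by
  fin_cases j <;> rfl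

theorem headIdx_succAbove_one (m : ℕ) (j : Fin 3) :
    (headIdx m j).succAbove 1 = headIdx m (j.succAbove 1) := by
  fin_cases j <;> rfl

theorem headInd_succAbove_succ_succ (m : ℕ) (j : Fin 3) (l : Fin m) :
    headInd m ((headIdx m j).succAbove l.succ.succ) = 0 := by
  refine if_neg ?_
  rw [Fin.succAbove_of_le_castSucc]
  · simp
  · rw [Fin.le_def]
    simp [headIdx]
    omega

theorem exists_median (r : Fin 3 → ℝ) :
    ∃ j : Fin 3, (r (j.succAbove 0) - r j) * (r (j.succAbove 1) - r j) ≤ 0 := by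
  by_contra! h
  have h0 : 0 < (r 1 - r 0) * (r 2 - r 0) := h 0
  have h1 : 0 < (r 0 - r 1) * (r 2 - r 1) := h 1
  have h2 : 0 < (r 0 - r 2) * (r 1 - r 2) := h 2
  rcases le_total (r 0) (r 1) with a | a <;> rcases le_total (r 0) (r 2) with b | b <;>
    rcases le_total (r 1) (r 2) with c | c <;> nlinarith

theorem abs_add_abs_le_of_mul_nonpos {x y : ℝ} (h : x * y ≤ 0) (t p q : ℝ) :
    |x| + |y| ≤ |x + t * p| + |y + t * q| + |t| * |p - q| := by
  rw [← abs_mul]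
  have e : t * (p - q) = t * p - t * q := by ring
  rw [e]
  rcases mul_nonpos_iff.1 h with ⟨hx, hy⟩ | ⟨hx, hy⟩
  · rw [abs_of_nonneg hx, abs_of_nonpos hy]
    linarith [le_abs_self (x + t * p), neg_abs_le (y + t * q), le_abs_self (t * p - t * q),
      neg_abs_le (t * p - t * q)]
  · rw [abs_of_nonpos hx, abs_of_nonneg hy]
    linarith [neg_abs_le (x + t * p), le_abs_self (y + t * q), le_abs_self (t * p - t * q),
      neg_abs_le (t * p - t * q)]

/-- The part of the convex hull of `±v₀, …, ±v_{m+2}` spanned by the vectors other than the `j`-th,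
with coefficients of opposite signs at the two remaining head vectors. -/
noncomputable def piece {m : ℕ} (v : Fin (m + 3) → EuclideanSpace ℝ (Fin (m + 2))) (j : Fin 3) :
    Set (EuclideanSpace ℝ (Fin (m + 2))) :=
  combMap (fun b => v ((headIdx m j).succAbove b)) '' halfCross m

theorem exists_mem_piece {m : ℕ} {v : Fin (m + 3) → EuclideanSpace ℝ (Fin (m + 2))}
    {u : Fin (m + 3) → ℝ} (huv : ∑ i, u i • v i = 0)
    (hu : ∀ i, |u i - headInd m i| ≤ 1 / (m + 3)) {c : Fin (m + 3) → ℝ} (hc : ∑ i, |c i| ≤ 1) :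
    ∃ j, ∑ i, c i • v i ∈ piece v j := by
  have hη : (1 : ℝ) / (m + 3) ≤ 1 / 3 := by
    apply one_div_le_one_div_of_le <;> norm_num
  have hhead : ∀ j, |u (headIdx m j) - 1| ≤ 1 / (m + 3) := fun j => by
    simpa [headInd_headIdx] using hu (headIdx m j)
  have hpos : ∀ j, 0 < u (headIdx m j) := fun j => by
    have := (abs_le.1 (hhead j)).1
    linarith
  obtain ⟨j, hj⟩ := exists_median fun j => c (headIdx m j) / u (headIdx m j)
  set q := headIdx m j with hq
  set t := c q / u q with ht
  have hcq : c q = t * u q := by rw [ht, div_mul_cancel₀ _ (hpos j).ne']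
  have hdiff : ∀ i, c (headIdx m i) - t * u (headIdx m i) =
      u (headIdx m i) * (c (headIdx m i) / u (headIdx m i) - t) := fun i => by
    rw [mul_sub, mul_div_cancel₀ _ (hpos i).ne', mul_comm t]
  have hopp : (c (q.succAbove 0) - t * u (q.succAbove 0)) *
      (c (q.succAbove 1) - t * u (q.succAbove 1)) ≤ 0 := by
    rw [hq, headIdx_succAbove_zero, headIdx_succAbove_one, hdiff, hdiff, mul_mul_mul_comm]
    exact mul_nonpos_of_nonneg_of_nonpos (mul_pos (hpos _) (hpos _)).le hj
  refine ⟨j, WithLp.toLp 2 fun b => c (q.succAbove b) - t * u (q.succAbove b), ⟨hopp, ?_⟩, ?_⟩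
  · refine le_trans ?_ hc
    have htail : ∀ l : Fin m, |u (q.succAbove l.succ.succ)| ≤ 1 / (m + 3) := fun l => by
      simpa [hq, headInd_succAbove_succ_succ] using hu (q.succAbove l.succ.succ)
    have hsum : ∑ l : Fin m, |u (q.succAbove l.succ.succ)| ≤ m * (1 / (m + 3)) := by
      simpa using Finset.sum_le_sum fun (l : Fin m) (_ : l ∈ Finset.univ) => htail l
    have hpq : |u (q.succAbove 0) - u (q.succAbove 1)| ≤ 2 * (1 / (m + 3)) := by
      have h1 := hhead (j.succAbove 0)
      have h2 := hhead (j.succAbove 1)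
      rw [← headIdx_succAbove_zero] at h1
      rw [← headIdx_succAbove_one] at h2
      rw [abs_le] at h1 h2 ⊢
      constructor <;> linarith [h1.1, h1.2, h2.1, h2.2]
    have huq : 1 - 1 / (m + 3) ≤ u q := by linarith [(abs_le.1 (hhead j)).1]
    have hbal : |u (q.succAbove 0) - u (q.succAbove 1)| + ∑ l : Fin m, |u (q.succAbove l.succ.succ)|
        ≤ u q := by
      have : (m + 3 : ℝ) * (1 / (m + 3)) = 1 := by field_simp
      linarith
    have hlt : ∑ l : Fin m, |c (q.succAbove l.succ.succ) - t * u (q.succAbove l.succ.succ)| ≤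
        ∑ l : Fin m, |c (q.succAbove l.succ.succ)| +
          |t| * ∑ l : Fin m, |u (q.succAbove l.succ.succ)| := by
      rw [Finset.mul_sum, ← Finset.sum_add_distrib]
      refine Finset.sum_le_sum fun l _ => (abs_sub _ _).trans (by rw [abs_mul])
    have hab := abs_add_abs_le_of_mul_nonpos hopp t (u (q.succAbove 0)) (u (q.succAbove 1))
    simp only [sub_add_cancel] at hab
    have hcq' : |c q| = |t| * u q := by rw [hcq, abs_mul, abs_of_pos (hpos j)]
    have hmul := mul_le_mul_of_nonneg_left hbal (abs_nonneg t)
    rw [Fin.sum_univ_succAbove _ q, Fin.sum_univ_succ, Fin.sum_univ_succ,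
      Fin.sum_univ_succ (n := m + 1), Fin.sum_univ_succ (n := m), Fin.succ_zero_eq_one, hcq']
    linarith
  · rw [combMap_apply]
    have h0 : ∑ i, (c i - t * u i) • v i = ∑ i, c i • v i := by
      simp only [sub_smul, mul_smul, Finset.sum_sub_distrib, ← Finset.smul_sum, huv, smul_zero,
        sub_zero]
    rw [← h0, Fin.sum_univ_succAbove _ q]
    rw [hcq, sub_self, zero_smul, zero_add]

theorem convexHull_subset_iUnion_piece {n m : ℕ} (h : m + 3 ≤ n)
    {v : Fin n → EuclideanSpace ℝ (Fin (m + 2))} {u : Fin (m + 3) → ℝ}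
    (huv : ∑ i, u i • v (Fin.castLE h i) = 0) (hu : ∀ i, |u i - headInd m i| ≤ 1 / (m + 3))
    (hext : ∀ i, ∃ c : Fin (m + 3) → ℝ, ∑ l, |c l| ≤ 1 ∧ v i = ∑ l, c l • v (Fin.castLE h l)) :
    convexHull ℝ (Set.range v ∪ Set.range fun i => -v i) ⊆
      ⋃ j, piece (fun l => v (Fin.castLE h l)) j := by
  refine Set.Subset.trans (b := {x | ∃ c : Fin (m + 3) → ℝ, ∑ l, |c l| ≤ 1 ∧
    x = ∑ l, c l • v (Fin.castLE h l)}) (convexHull_min ?_ ?_) ?_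
  · rintro _ (⟨i, rfl⟩ | ⟨i, rfl⟩)
    · exact hext i
    · obtain ⟨c, hc, hi⟩ := hext i
      exact ⟨-c, by simpa using hc, by simp [hi]⟩
  · rintro _ ⟨c, hc, rfl⟩ _ ⟨d, hd, rfl⟩ α β hα hβ hαβ
    refine ⟨fun l => α * c l + β * d l, ?_, ?_⟩
    · calc ∑ l, |α * c l + β * d l| ≤ ∑ l, (α * |c l| + β * |d l|) := by
            refine Finset.sum_le_sum fun l _ => (abs_add_le _ _).trans ?_
            rw [abs_mul, abs_mul, abs_of_nonneg hα, abs_of_nonneg hβ]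
        _ = α * ∑ l, |c l| + β * ∑ l, |d l| := by
            rw [Finset.sum_add_distrib, Finset.mul_sum, Finset.mul_sum]
        _ ≤ α * 1 + β * 1 := by gcongr
        _ = 1 := by linarith
    · simp only [add_smul, mul_smul, Finset.sum_add_distrib, Finset.smul_sum]
  · rintro _ ⟨c, hc, rfl⟩
    exact Set.mem_iUnion.2 (exists_mem_piece huv hu hc)

theorem volume_piece {m : ℕ} (v : Fin (m + 3) → EuclideanSpace ℝ (Fin (m + 2))) (j : Fin 3) :
    volume (piece v j) = ENNReal.ofReal (minorAbs v (headIdx m j)) * volume (halfCross m) :=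
  volume_combMap_image _ _

theorem sum_volume_piece {m : ℕ} (v : Fin (m + 3) → EuclideanSpace ℝ (Fin (m + 2))) :
    ∑ j, volume (piece v j) =
      ENNReal.ofReal (∑ j, minorAbs v (headIdx m j)) * volume (halfCross m) := by
  rw [ENNReal.ofReal_sum_of_nonneg (f := fun j => minorAbs v (headIdx m j))
    fun _ _ => abs_nonneg _, Finset.sum_mul]
  simp_rw [volume_piece]

theorem abs_sub_mean_le {C : Fin 3 → ℝ} {j : Fin 3} (hj : C j = 0)
    (hmul : C (j.succAbove 0) * C (j.succAbove 1) ≤ 0) (i : Fin 3) :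
    |C j - (∑ l, C l) / 3| ≤ |C i - (∑ l, C l) / 3| := by
  rw [← sq_le_sq, Fin.sum_univ_three]
  fin_cases j
  · change C 0 = 0 at hj
    change C 1 * C 2 ≤ 0 at hmul
    fin_cases i <;> simp [hj] <;> nlinarith [sq_nonneg (C 1), sq_nonneg (C 2)]
  · change C 1 = 0 at hj
    change C 0 * C 2 ≤ 0 at hmul
    fin_cases i <;> simp [hj] <;> nlinarith [sq_nonneg (C 0), sq_nonneg (C 2)]
  · change C 2 = 0 at hj
    change C 0 * C 1 ≤ 0 at hmul
    fin_cases i <;> simp [hj] <;> nlinarith [sq_nonneg (C 0), sq_nonneg (C 1)]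

theorem abs_inner_le_of_mem_piece {m : ℕ} {w : Fin (m + 3) → EuclideanSpace ℝ (Fin (m + 2))}
    (hw : ∀ i j, ⟪w i, w j⟫ = (if i = j then 1 else 0) - headInd m i * headInd m j / 3)
    {j : Fin 3} {x : EuclideanSpace ℝ (Fin (m + 2))} (hx : x ∈ piece w j) (i : Fin 3) :
    |⟪w (headIdx m j), x⟫| ≤ |⟪w (headIdx m i), x⟫| := by
  obtain ⟨y, hy, rfl⟩ := hx
  set c : Fin (m + 3) → ℝ := (headIdx m j).insertNth (0 : ℝ) fun b => y b with hc
  have hsum : combMap (fun b => w ((headIdx m j).succAbove b)) y = ∑ l, c l • w l := by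
    rw [combMap_apply, Fin.sum_univ_succAbove _ (headIdx m j)]
    simp [hc]
  have hinner : ∀ i, ⟪w (headIdx m i), ∑ l, c l • w l⟫ =
      c (headIdx m i) - (∑ l, c (headIdx m l)) / 3 := fun i => by
    rw [← sum_headInd_smul, inner_sum]
    simp only [inner_smul_right, hw, headInd_headIdx, mul_sub, Finset.sum_sub_distrib,
      smul_eq_mul, Finset.sum_div]
    simp
    exact Finset.sum_congr rfl fun l _ => by ring
  have hj : c (headIdx m j) = 0 := by simp [hc]
  have hmul : c (headIdx m (j.succAbove 0)) * c (headIdx m (j.succAbove 1)) ≤ 0 := by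
    rw [← headIdx_succAbove_zero, ← headIdx_succAbove_one]
    simpa [hc] using hy.1
  rw [hsum, hinner, hinner]
  exact abs_sub_mean_le (C := fun l => c (headIdx m l)) hj hmul i

theorem aedisjoint_piece {m : ℕ} {w : Fin (m + 3) → EuclideanSpace ℝ (Fin (m + 2))}
    (hw : ∀ i j, ⟪w i, w j⟫ = (if i = j then 1 else 0) - headInd m i * headInd m j / 3)
    {i j : Fin 3} (hij : i ≠ j) : AEDisjoint volume (piece w i) (piece w j) := by
  have hij' : headIdx m i ≠ headIdx m j := fun h => hij (Fin.castLE_injective _ h)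
  have hsub : w (headIdx m i) - w (headIdx m j) ≠ 0 := fun h => by
    have := congrArg (fun y => ⟪w (headIdx m i), y⟫) h
    simp [inner_sub_right, hw, headInd_headIdx, hij', -inner_self_eq_norm_sq_to_K] at this
  have hadd : w (headIdx m i) + w (headIdx m j) ≠ 0 := fun h => by
    have := congrArg (fun y => ⟪w (headIdx m i), y⟫) h
    simp only [inner_add_right, hw, headInd_headIdx, hij', inner_zero_right] at this
    norm_num at this
  refine measure_mono_null ?_
    (measure_union_null (volume_inner_eq_zero hsub) (volume_inner_eq_zero hadd))
  rintro x ⟨hxi, hxj⟩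
  have h := le_antisymm (abs_inner_le_of_mem_piece hw hxi j) (abs_inner_le_of_mem_piece hw hxj i)
  rcases abs_eq_abs.1 h with h | h
  · left; simp [inner_sub_left, h]
  · right; simp [inner_add_left, h]

theorem volume_iUnion_piece {m : ℕ} {w : Fin (m + 3) → EuclideanSpace ℝ (Fin (m + 2))}
    (hw : ∀ i j, ⟪w i, w j⟫ = (if i = j then 1 else 0) - headInd m i * headInd m j / 3) :
    volume (⋃ j, piece w j) =
      ENNReal.ofReal (∑ j, minorAbs w (headIdx m j)) * volume (halfCross m) := by
  rw [measure_iUnion₀ (fun _ _ h => aedisjoint_piece hw h), tsum_fintype, sum_volume_piece]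
  exact fun j => ((isCompact_halfCross m).image
    (LinearMap.continuous_of_finiteDimensional _)).measurableSet.nullMeasurableSet

theorem eventually_exists_coeff {k n : ℕ} {v : Fin n → EuclideanSpace ℝ (Fin k)}
    {σ : Fin k → Fin n} (hdet : (colMatrix fun b => v (σ b)).det ≠ 0) {i : Fin n} {c : Fin k → ℝ}
    (hc : v i = ∑ b, c b • v (σ b)) {η : ℝ} (hη : 0 < η) :
    ∀ᶠ v' in nhds v, ∃ c' : Fin k → ℝ, (∀ b, |c' b - c b| < η) ∧
      v' i = ∑ b, c' b • v' (σ b) := by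
  set M : (Fin n → EuclideanSpace ℝ (Fin k)) → Matrix (Fin k) (Fin k) ℝ :=
    fun v' => colMatrix fun b => v' (σ b) with hM
  have hMcont : Continuous M := by
    refine continuous_matrix fun a b => ?_
    simp only [hM, colMatrix, Matrix.of_apply]
    fun_prop
  have hmul : ∀ (v' : Fin n → EuclideanSpace ℝ (Fin k)) (d : Fin k → ℝ),
      (M v').mulVec d = ∑ b, d b • v' (σ b) := fun v' d => by
    ext a
    simp [Matrix.mulVec, dotProduct, hM, colMatrix, mul_comm]
  set f : (Fin n → EuclideanSpace ℝ (Fin k)) → Fin k → ℝ :=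
    fun v' => (M v')⁻¹.mulVec (v' i) with hf
  have hdetcont : Continuous fun v' => (M v').det := hMcont.matrix_det
  have hfv : f v = c := by
    have h1 : (v i).ofLp = (M v).mulVec c := by rw [hmul, hc]
    rw [hf]
    change (M v)⁻¹.mulVec (v i).ofLp = c
    rw [h1, Matrix.mulVec_mulVec, Matrix.nonsing_inv_mul _ (isUnit_iff_ne_zero.2 hdet),
      Matrix.one_mulVec]
  have hfcont : ContinuousAt f v := by
    have hinv : ContinuousAt (fun v' => (M v').det⁻¹ • (M v').adjugate.mulVec (v' i)) v := by
      refine (hdetcont.continuousAt.inv₀ hdet).smul (Continuous.continuousAt ?_)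
      exact hMcont.matrix_adjugate.matrix_mulVec (by fun_prop)
    convert hinv using 2 with v'
    change (M v')⁻¹.mulVec (v' i).ofLp = _
    rw [Matrix.inv_def, Ring.inverse_eq_inv', Matrix.smul_mulVec]
  have hclose : ∀ᶠ v' in nhds v, ∀ b, |f v' b - c b| < η := by
    rw [Filter.eventually_all]
    intro b
    have := (continuous_apply b).continuousAt.comp hfcont
    have h2 := Metric.continuousAt_iff'.1 this η hη
    simpa [hfv, Real.dist_eq] using h2
  filter_upwards [hclose, hdetcont.continuousAt.eventually_ne hdet] with v' h1 h2
  refine ⟨f v', h1, ?_⟩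
  have h3 : (M v').mulVec (f v') = (v' i).ofLp := by
    rw [hf]
    change (M v').mulVec ((M v')⁻¹.mulVec (v' i).ofLp) = _
    rw [Matrix.mulVec_mulVec, Matrix.mul_nonsing_inv _ (isUnit_iff_ne_zero.2 h2),
      Matrix.one_mulVec]
  rw [hmul] at h3
  exact (WithLp.ofLp_injective 2 h3).symm

theorem det_succ_ne_zero {m : ℕ} {w : Fin (m + 3) → EuclideanSpace ℝ (Fin (m + 2))}
    (hw : IsUframe w) (hhead : ∑ i, headInd m i • w i = 0) :
    (colMatrix fun b : Fin (m + 2) => w b.succ).det ≠ 0 := by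
  rw [← det_combMap]
  have hsurj : Function.Surjective (combMap fun b : Fin (m + 2) => w b.succ) := by
    intro y
    have h : ∑ i, (⟪w i, y⟫ - ⟪w 0, y⟫ * headInd m i) • w i = y := by
      simp only [sub_smul, mul_smul, Finset.sum_sub_distrib, ← Finset.smul_sum, hhead, smul_zero,
        sub_zero]
      exact hw y
    refine ⟨WithLp.toLp 2 fun b => ⟪w b.succ, y⟫ - ⟪w 0, y⟫ * headInd m b.succ, ?_⟩
    rw [Fin.sum_univ_succ] at h
    rw [combMap_apply]
    simpa [headInd] using h
  have hinj := LinearMap.injective_iff_surjective.2 hsurj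
  exact (LinearEquiv.isUnit_det' (LinearEquiv.ofBijective _ ⟨hinj, hsurj⟩)).ne_zero

theorem IsUframe.exists_extend {p n k : ℕ} (h : p ≤ n) {w : Fin p → EuclideanSpace ℝ (Fin k)}
    (hw : IsUframe w) : ∃ v : Fin n → EuclideanSpace ℝ (Fin k), IsUframe v ∧
      (∀ i, v (Fin.castLE h i) = w i) ∧ ∀ i : Fin n, p ≤ i → v i = 0 := by
  obtain ⟨r, rfl⟩ := Nat.exists_eq_add_of_le h
  refine ⟨Fin.append w 0, fun x => ?_, fun i => Fin.append_left w 0 i, fun i hi => ?_⟩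
  · simpa [Fin.sum_univ_add] using hw x
  · obtain ⟨j, rfl⟩ : ∃ j, i = Fin.natAdd p j := ⟨⟨i - p, by omega⟩, by ext; simp; omega⟩
    exact Fin.append_right w 0 j

theorem volume_crossPolytope_le_Vmax {n k : ℕ} (hn : 0 < n) (h : k ≤ n) :
    volume (crossPolytope k) ≤ Vmax n k := by
  have hw : IsUframe (EuclideanSpace.basisFun (Fin k) ℝ) :=
    (EuclideanSpace.basisFun (Fin k) ℝ).sum_repr'
  obtain ⟨v, hv, hvw, -⟩ := hw.exists_extend h
  refine le_trans (measure_mono fun x hx => ?_) (le_iSup₂ (f := fun v _ => Fvol v) v hv)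
  rw [← (EuclideanSpace.basisFun (Fin k) ℝ).sum_repr x]
  exact sum_smul_mem_convexHull (fun i => ⟨_, hvw i⟩) hx hn

theorem eventually_Fvol_le {n m : ℕ} (h : m + 3 ≤ n) {v : Fin n → EuclideanSpace ℝ (Fin (m + 2))}
    (hframe : IsUframe fun i => v (Fin.castLE h i))
    (hhead : ∑ i, headInd m i • v (Fin.castLE h i) = 0) (hzero : ∀ i : Fin n, m + 3 ≤ i → v i = 0) :
    ∀ᶠ v' in nhds v, IsUframe v' → Fvol v' ≤ ENNReal.ofReal √3 * volume (halfCross m) := by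
  have hη : (0 : ℝ) < 1 / (m + 3) := by positivity
  have hdet := det_succ_ne_zero hframe hhead
  have h0 : v (Fin.castLE h 0) =
      ∑ b : Fin (m + 2), (-headInd m b.succ) • v (Fin.castLE h b.succ) := by
    rw [Fin.sum_univ_succ] at hhead
    simp only [neg_smul, Finset.sum_neg_distrib]
    exact eq_neg_of_add_eq_zero_left (by simpa [headInd] using hhead)
  have hrest : ∀ i : Fin n, ∀ᶠ v' in nhds v, m + 3 ≤ (i : ℕ) → ∃ c' : Fin (m + 2) → ℝ,
      (∀ b, |c' b - 0| < 1 / (m + 3 : ℝ)) ∧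
        v' i = ∑ b, c' b • v' (Fin.castLE h b.succ) := fun i => by
    by_cases hi : m + 3 ≤ (i : ℕ)
    · filter_upwards [eventually_exists_coeff (σ := fun b => Fin.castLE h b.succ) hdet (i := i)
        (c := fun _ => 0) (by simp [hzero i hi]) hη] with v' hv' _ using hv'
    · exact Filter.Eventually.of_forall fun _ hi' => absurd hi' hi
  filter_upwards [eventually_exists_coeff (σ := fun b => Fin.castLE h b.succ) hdet h0 hη,
    Filter.eventually_all.2 hrest] with v' ⟨c, hc, hc0⟩ hv' hframe'
  have hsub : convexHull ℝ (Set.range v' ∪ Set.range fun i => -v' i) ⊆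
      ⋃ j, piece (fun l => v' (Fin.castLE h l)) j := by
    refine convexHull_subset_iUnion_piece h (u := Fin.cons 1 (-c)) ?_ ?_ fun i => ?_
    · rw [Fin.sum_univ_succ]
      simp [hc0]
    · intro i
      refine Fin.cases ?_ (fun b => ?_) i
      · simpa [headInd] using hη.le
      · rw [Fin.cons_succ, Pi.neg_apply, ← abs_neg, neg_sub, sub_neg_eq_add, add_comm]
        simpa only [sub_neg_eq_add] using (hc b).le
    · by_cases hi : m + 3 ≤ (i : ℕ)
      · obtain ⟨d, hd, hdi⟩ := hv' i hi
        refine ⟨Fin.cons 0 d, ?_, ?_⟩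
        · rw [Fin.sum_univ_succ]
          have : ∑ b, |d b| ≤ ∑ _b : Fin (m + 2), 1 / (m + 3 : ℝ) :=
            Finset.sum_le_sum fun b _ => by simpa using (hd b).le
          have h1 : ((m : ℝ) + 2) * (1 / (m + 3)) ≤ 1 := by
            rw [mul_one_div, div_le_one (by positivity)]; linarith
          simp only [Finset.sum_const, Finset.card_univ, Fintype.card_fin, nsmul_eq_mul] at this
          push_cast at this
          simpa using this.trans h1
        · rw [Fin.sum_univ_succ]
          simpa using hdi
      · refine ⟨Pi.single ⟨i, by omega⟩ 1, ?_, ?_⟩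
        · simp [Pi.single_apply, apply_ite abs]
        · simp [Pi.single_apply, ite_smul]
  have hrows : ∀ a, ∑ i, v' (Fin.castLE h i) a ^ 2 ≤ 1 := fun a => by
    have h1 := isUframe_iff.1 hframe' a a
    rw [if_pos rfl] at h1
    rw [← h1, ← Fin.coe_castLEEmb]
    rw [← Finset.sum_map Finset.univ (Fin.castLEEmb h) fun i => v' i a ^ 2]
    simp_rw [sq]
    exact Finset.sum_le_univ_sum_of_nonneg fun i => mul_self_nonneg _
  calc Fvol v' ≤ ∑ j, volume (piece (fun l => v' (Fin.castLE h l)) j) :=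
        (measure_mono hsub).trans (measure_iUnion_fintype_le _ _)
    _ ≤ _ := by
      rw [sum_volume_piece]
      gcongr
      exact sum_minorAbs_le _ hrows

theorem le_Fvol {n m : ℕ} (h : m + 3 ≤ n) {v : Fin n → EuclideanSpace ℝ (Fin (m + 2))}
    (hgram : ∀ i j, ⟪v (Fin.castLE h i), v (Fin.castLE h j)⟫ =
      (if i = j then 1 else 0) - headInd m i * headInd m j / 3)
    (hminor : √3 ≤ ∑ j, minorAbs (fun i => v (Fin.castLE h i)) (headIdx m j)) :
    ENNReal.ofReal √3 * volume (halfCross m) ≤ Fvol v := by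
  calc _ ≤ volume (⋃ j, piece (fun i => v (Fin.castLE h i)) j) := by
        rw [volume_iUnion_piece hgram]
        gcongr
    _ ≤ _ := by
      refine measure_mono (Set.iUnion_subset fun j => ?_)
      rintro _ ⟨y, hy, rfl⟩
      rw [combMap_apply]
      exact sum_smul_mem_convexHull (fun i => ⟨_, rfl⟩) hy.2 (by omega)

/-- For every `n > k ≥ 2` there exists an `(n,k)`-uframe which is a local maximum of `F`
on the set of `(n,k)`-uframes but not a global maximum. -/
theorem exists_local_not_global_max (n k : ℕ) (hk : 2 ≤ k) (hkn : k < n) :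
    ∃ v : Fin n → EuclideanSpace ℝ (Fin k), IsUframe v ∧
      (∃ ε > (0 : ℝ), ∀ v' : Fin n → EuclideanSpace ℝ (Fin k), IsUframe v' →
        (∀ i, ‖v' i - v i‖ < ε) → Fvol v' ≤ Fvol v) ∧
      Fvol v < Vmax n k := by
  obtain ⟨m, rfl⟩ := Nat.exists_eq_add_of_le' hk
  have h : m + 3 ≤ n := hkn
  obtain ⟨w, hw, hgram, hhead, hminor⟩ := exists_hexagonal_frame m
  obtain ⟨v, hv, hvw, hzero⟩ := hw.exists_extend h
  obtain rfl : (fun i => v (Fin.castLE h i)) = w := funext hvw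
  have hloc := eventually_Fvol_le h hw hhead hzero
  refine ⟨v, hv, ?_, ?_⟩
  · obtain ⟨ε, hε, hball⟩ := Metric.eventually_nhds_iff.1 hloc
    refine ⟨ε, hε, fun v' hv' hclose => (hball ?_ hv').trans (le_Fvol h hgram hminor)⟩
    exact (dist_pi_lt_iff hε).2 fun i => by simpa [dist_eq_norm] using hclose i
  · calc Fvol v ≤ ENNReal.ofReal √3 * volume (halfCross m) := hloc.self_of_nhds hv
      _ < 2 * volume (halfCross m) := by
        refine ENNReal.mul_lt_mul_left (volume_halfCross_ne_zero m) (volume_halfCross_ne_top m) ?_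
        rw [← ENNReal.ofReal_ofNat 2]
        refine (ENNReal.ofReal_lt_ofReal_iff (by norm_num)).2 ?_
        rw [Real.sqrt_lt' (by norm_num)]
        norm_num
      _ = volume (crossPolytope (m + 2)) := (volume_crossPolytope m).symm
      _ ≤ Vmax n (m + 2) := volume_crossPolytope_le_Vmax (by omega) hkn.le
end
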